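/- arXiv:1101.5256 — 5 statements merged into one kernel-verified Lean document; each statement's English description precedes it below -/
import Mathlib

section
/- (Patch test for the atomistic model.) For every matrix A ∈ ℝ^{d×d} and every periodic displacement u ∈ 𝓤, the function t ↦ E_a(y_A + t u) is differentiable at t = 0 with derivative 0; equivalently, ε^d Σ_{x∈𝓛} Σ_{r∈ℛ} ∂_r V(Aℛ) · D_r u(x) = 0. -/
open scoped BigOperators RealInnerProductSpace

noncomputable section

/-- The lattice spacing `ε = 1/N`. -/
def eps (N : ℕ) : ℝ := 1 / N

/-- The periodic reference cell `𝓛 = ε·{−N+1,…,N}^d`, in integer coordinates. -/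
def latCell (d N : ℕ) : Finset (Fin d → ℤ) :=
  Fintype.piFinset fun _ => Finset.Icc (-(N : ℤ) + 1) (N : ℤ)

/-- The finite difference operator `D_r v(x) = (v(x+εr) − v(x))/ε`. -/
def fd (d : ℕ) (ε : ℝ) (r : Fin d → ℤ) (v : (Fin d → ℤ) → EuclideanSpace ℝ (Fin d))
    (x : Fin d → ℤ) : EuclideanSpace ℝ (Fin d) :=
  ε⁻¹ • (v (x + r) - v x)

/-- The atomistic energy `E_a(y) = ε^d ∑_{x∈𝓛} V(D_ℛ y(x))`. -/
def Ea (d N : ℕ) (R : Finset (Fin d → ℤ)) (V : (R → EuclideanSpace ℝ (Fin d)) → ℝ)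
    (y : (Fin d → ℤ) → EuclideanSpace ℝ (Fin d)) : ℝ :=
  eps N ^ d * ∑ x ∈ latCell d N, V fun r => fd d (eps N) (↑r) y x

/-- Real vector from coordinates. -/
def toVec (d : ℕ) (f : Fin d → ℝ) : EuclideanSpace ℝ (Fin d) :=
  (WithLp.equiv 2 (Fin d → ℝ)).symm f

/-- Homogeneous deformation `y_A(x) = A x` (lattice point `x` sits at `εx ∈ ℝ^d`). -/
def yhom (d N : ℕ) (A : Matrix (Fin d) (Fin d) ℝ) (x : Fin d → ℤ) :
    EuclideanSpace ℝ (Fin d) :=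
  toVec d (A.mulVec fun i => eps N * (x i : ℝ))

/-- A map on `εℤ^d` is `2ℤ^d`-periodic iff it is `2N`-periodic in integer coordinates. -/
def LatPeriodic (d N : ℕ) (u : (Fin d → ℤ) → EuclideanSpace ℝ (Fin d)) : Prop :=
  ∀ x ξ : Fin d → ℤ, u (x + (2 * N : ℤ) • ξ) = u x

/-- Summation over the reference cell is invariant under shifts of a periodic function. -/
theorem sum_latCell_shift {d N : ℕ} (hN : 1 ≤ N) {E : Type*} [AddCommMonoid E]
    (f : (Fin d → ℤ) → E) (hf : ∀ x ξ : Fin d → ℤ, f (x + (2 * N : ℤ) • ξ) = f x)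
    (r : Fin d → ℤ) : ∑ x ∈ latCell d N, f (x + r) = ∑ x ∈ latCell d N, f x := by
  have hp : (0 : ℤ) < 2 * N := by omega
  let w : (Fin d → ℤ) → Fin d → ℤ := fun x i => toIocMod hp (-(N : ℤ)) (x i)
  have w_mem (x) : w x ∈ latCell d N := by
    simp only [latCell, Fintype.mem_piFinset, Finset.mem_Icc]
    intro i
    have h := toIocMod_mem_Ioc hp (-(N : ℤ)) (x i)
    rw [Set.mem_Ioc] at h
    simp only [w]
    omega
  have w_eq (x) : w x = x + (2 * N : ℤ) • fun i => -toIocDiv hp (-(N : ℤ)) (x i) := by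
    ext i
    simp only [w, toIocMod, Pi.add_apply, Pi.smul_apply, smul_eq_mul]
    ring
  have w_unique (x ξ) (hx : x ∈ latCell d N) : w (x + (2 * N : ℤ) • ξ) = x := by
    ext i
    simp only [latCell, Fintype.mem_piFinset, Finset.mem_Icc] at hx
    have := hx i
    refine (toIocMod_eq_iff hp).2 ⟨?_, ξ i, ?_⟩
    · rw [Set.mem_Ioc]
      omega
    · simp only [Pi.add_apply, Pi.smul_apply, smul_eq_mul]
      ring
  refine Finset.sum_nbij' (fun x => w (x + r)) (fun x => w (x - r))
    (fun x _ => w_mem _) (fun x _ => w_mem _) ?_ ?_ ?_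
  · intro x hx
    rw [w_eq (x + r), add_right_comm, add_sub_cancel_right, w_unique _ _ hx]
  · intro x hx
    rw [w_eq (x - r), add_right_comm, sub_add_cancel, w_unique _ _ hx]
  · intro x _
    rw [w_eq, hf]

theorem eps_ne_zero {N : ℕ} (hN : 1 ≤ N) : eps N ≠ 0 :=
  one_div_ne_zero (Nat.cast_ne_zero.2 (by omega))

theorem sum_latCell_fd {d N : ℕ} (hN : 1 ≤ N) {u : (Fin d → ℤ) → EuclideanSpace ℝ (Fin d)}
    (hu : LatPeriodic d N u) (r : Fin d → ℤ) :
    ∑ x ∈ latCell d N, fd d (eps N) r u x = 0 := by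
  simp only [fd, ← Finset.smul_sum, Finset.sum_sub_distrib, sum_latCell_shift hN u hu, sub_self,
    smul_zero]

theorem fd_yhom {d N : ℕ} (hN : 1 ≤ N) (A : Matrix (Fin d) (Fin d) ℝ) (r x : Fin d → ℤ) :
    fd d (eps N) r (yhom d N A) x = toVec d (A.mulVec fun i => (r i : ℝ)) := by
  have h : (fun i => eps N * ((x + r) i : ℝ)) =
      (fun i => eps N * (x i : ℝ)) + eps N • fun i => (r i : ℝ) := by
    ext i
    simp only [Pi.add_apply, Pi.smul_apply, smul_eq_mul]
    push_cast
    ring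
  ext i
  simp only [fd, yhom, h, Matrix.mulVec_add, Matrix.mulVec_smul]
  simp [toVec, eps_ne_zero hN]

theorem fd_add_smul {d : ℕ} (ε t : ℝ) (r : Fin d → ℤ)
    (y u : (Fin d → ℤ) → EuclideanSpace ℝ (Fin d)) (x : Fin d → ℤ) :
    fd d ε r (y + t • u) x = fd d ε r y x + t • fd d ε r u x := by
  simp only [fd, Pi.add_apply, Pi.smul_apply]
  module

/-- patch test for the atomistic model: for every `A` and every periodic
displacement `u`, `t ↦ E_a(y_A + tu)` is differentiable at `0` with derivative `0`;
equivalently `ε^d ∑_{x∈𝓛} ∑_{r∈ℛ} ∂_r V(Aℛ) · D_r u(x) = 0`. -/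
theorem stmt_2 (d N : ℕ) (hd : 1 ≤ d) (hN : 1 ≤ N)
    (R : Finset (Fin d → ℤ)) (hR : (0 : Fin d → ℤ) ∉ R)
    (V : (R → EuclideanSpace ℝ (Fin d)) → ℝ) (hV : ContDiff ℝ 1 V)
    (DV : (R → EuclideanSpace ℝ (Fin d)) → R → EuclideanSpace ℝ (Fin d))
    (hDV : ∀ (g : R → EuclideanSpace ℝ (Fin d)) (r : R) (a : EuclideanSpace ℝ (Fin d)),
      ⟪DV g r, a⟫ = fderiv ℝ V g (Pi.single r a))
    (A : Matrix (Fin d) (Fin d) ℝ)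
    (u : (Fin d → ℤ) → EuclideanSpace ℝ (Fin d)) (hu : LatPeriodic d N u) :
    HasDerivAt (fun t : ℝ => Ea d N R V (yhom d N A + t • u)) 0 0 ∧
    eps N ^ d * ∑ x ∈ latCell d N, ∑ r : R,
      ⟪DV (fun s => toVec d (A.mulVec fun i => ((s : Fin d → ℤ) i : ℝ))) r,
        fd d (eps N) (↑r) u x⟫ = 0 := by
  constructor
  · set G : R → EuclideanSpace ℝ (Fin d) :=
      fun s => toVec d (A.mulVec fun i => ((s : Fin d → ℤ) i : ℝ))
    let w (x : Fin d → ℤ) : R → EuclideanSpace ℝ (Fin d) := fun r => fd d (eps N) r u x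
    have hE : (fun t : ℝ => Ea d N R V (yhom d N A + t • u)) =
        fun t => eps N ^ d * ∑ x ∈ latCell d N, V (G + t • w x) := by
      ext t
      simp only [Ea, fd_add_smul, fd_yhom hN]
      rfl
    have hline (x) : HasDerivAt (fun t : ℝ => V (G + t • w x)) (fderiv ℝ V G (w x)) 0 :=
      ((hV.differentiable one_ne_zero) G).hasFDerivAt.hasLineDerivAt (w x)
    have hsum : ∑ x ∈ latCell d N, w x = 0 := by
      ext1 r
      rw [Finset.sum_apply]
      exact sum_latCell_fd hN hu r
    have key := (HasDerivAt.fun_sum fun x (_ : x ∈ latCell d N) => hline x).const_mul (eps N ^ d)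
    rwa [← map_sum, hsum, map_zero, mul_zero, ← hE] at key
  · rw [Finset.sum_comm]
    simp only [← inner_sum, sum_latCell_fd hN hu, inner_zero_right, Finset.sum_const_zero, mul_zero]
end
end

section
/- (Consistency error of the QCE method.) Let y ∈ 𝓨 and p ∈ [1,∞] with conjugate exponent p' = p/(p−1). Set G := (1/2)( |φ₂'(2y'_{−K−1})| + |φ₂'(2y'_{−K+1})| + |φ₂'(2y'_K)| + |φ₂'(2y'_{K+2})| ) and 𝓝_i := {−K−1, −K, K, K+1}, 𝓝_c' := {−N+1,…,−K−1} ∪ {K+2,…,N}. Then for every 2N-periodic displacement u ∈ 𝓤, |δE_qce(y)[u] − δE_a(y)[u]| ≤ ( ε^{1/p} G + ε m₂' ‖y''‖_{ℓ^p_ε(𝓝_i)} + ε² m₂' ‖y'''‖_{ℓ^p_ε(𝓝_c')} + ε² m₂'' ‖y''‖²_{ℓ^{2p}_ε(𝓝_c ∪ {−K,K})} ) · ‖u'‖_{ℓ^{p'}_ε({−N+1,…,N})}. -/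
open scoped BigOperators ENNReal NNReal

noncomputable section

/-- Backward difference `y'_n = (y_n − y_{n−1})/ε`. -/
def d1 (ε : ℝ) (y : ℤ → ℝ) (n : ℤ) : ℝ := (y n - y (n - 1)) / ε

/-- Second difference `y''_n = (y'_{n+1} − y'_n)/ε`. -/
def d2 (ε : ℝ) (y : ℤ → ℝ) (n : ℤ) : ℝ := (d1 ε y (n + 1) - d1 ε y n) / ε

/-- Third difference `y'''_n = (y'_{n+1} − 2y'_n + y'_{n−1})/ε²`. -/
def d3 (ε : ℝ) (y : ℤ → ℝ) (n : ℤ) : ℝ :=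
  (d1 ε y (n + 1) - 2 * d1 ε y n + d1 ε y (n - 1)) / ε ^ 2

/-- The full index range `{−N+1,…,N}`. -/
def rng (N : ℕ) : Finset ℤ := Finset.Icc (-(N : ℤ) + 1) (N : ℤ)

/-- The atomistic index set `𝓝_a = {−K,…,K}`. -/
def Na (K : ℕ) : Finset ℤ := Finset.Icc (-(K : ℤ)) (K : ℤ)

/-- The continuum index set `𝓝_c = {−N+1,…,N} \ 𝓝_a`. -/
def Nc (N K : ℕ) : Finset ℤ := rng N \ Na K

/-- `𝓝_c' = {−N+1,…,−K−1} ∪ {K+2,…,N}`. -/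
def Nc' (N K : ℕ) : Finset ℤ :=
  Finset.Icc (-(N : ℤ) + 1) (-(K : ℤ) - 1) ∪ Finset.Icc ((K : ℤ) + 2) (N : ℤ)

/-- The 1D atomistic energy with first and second neighbour interactions. -/
def Ea1 (N : ℕ) (ε : ℝ) (φ1 φ2 : ℝ → ℝ) (y : ℤ → ℝ) : ℝ :=
  ε * ∑ n ∈ rng N, φ1 (d1 ε y n) + ε * ∑ n ∈ rng N, φ2 (d1 ε y n + d1 ε y (n + 1))

/-- The 1D QCE energy. -/
def Eqce (N K : ℕ) (ε : ℝ) (φ1 φ2 : ℝ → ℝ) (y : ℤ → ℝ) : ℝ :=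
  ε * ∑ n ∈ Na K, (φ1 (d1 ε y n) + φ1 (d1 ε y (n + 1))
      + φ2 (d1 ε y (n - 1) + d1 ε y n) + φ2 (d1 ε y (n + 1) + d1 ε y (n + 2))) / 2
    + ε * ∑ n ∈ Nc N K, (φ1 (d1 ε y n) + φ1 (d1 ε y (n + 1))
      + φ2 (2 * d1 ε y n) + φ2 (2 * d1 ε y (n + 1))) / 2

/-- The weighted `ℓ^p_ε` norm over an index set `S`, for `p ∈ [1,∞]`. -/
def lpNorm (ε : ℝ) (p : ℝ≥0∞) (S : Finset ℤ) (v : ℤ → ℝ) : ℝ :=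
  if p = ∞ then ((S.sup fun n => ‖v n‖₊ : ℝ≥0) : ℝ)
  else ε ^ (1 / p.toReal) * (∑ n ∈ S, |v n| ^ p.toReal) ^ (1 / p.toReal)

section LpNorm

variable {ε : ℝ} {p q : ℝ≥0∞}

lemma lpNorm_nonneg (hε : 0 ≤ ε) (S : Finset ℤ) (v : ℤ → ℝ) : 0 ≤ lpNorm ε p S v := by
  unfold lpNorm
  split_ifs <;> positivity

lemma lpNorm_top (S : Finset ℤ) (v : ℤ → ℝ) :
    lpNorm ε ∞ S v = ((S.sup fun n => ‖v n‖₊ : ℝ≥0) : ℝ) := if_pos rfl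

lemma lpNorm_of_ne_top (hp : p ≠ ∞) (S : Finset ℤ) (v : ℤ → ℝ) :
    lpNorm ε p S v
      = ε ^ (1 / p.toReal) * (∑ n ∈ S, |v n| ^ p.toReal) ^ (1 / p.toReal) := if_neg hp

lemma lpNorm_one (S : Finset ℤ) (v : ℤ → ℝ) : lpNorm ε 1 S v = ε * ∑ n ∈ S, |v n| := by
  simp [lpNorm_of_ne_top]

lemma abs_le_lpNorm_top {S : Finset ℤ} {n : ℤ} (hn : n ∈ S) (v : ℤ → ℝ) :
    |v n| ≤ lpNorm ε ∞ S v := by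
  rw [lpNorm_top, ← Real.norm_eq_abs, ← coe_nnnorm, NNReal.coe_le_coe]
  exact Finset.le_sup (f := fun n => ‖v n‖₊) hn

/-- Weighted norms grow under an injective reindexing that dominates the entries. -/
lemma lpNorm_le_of_injOn (hε : 0 ≤ ε) {S T : Finset ℤ} {c d : ℤ → ℝ} (σ : ℤ → ℤ)
    (hσ : Set.InjOn σ S) (hST : ∀ n ∈ S, σ n ∈ T) (hcd : ∀ n ∈ S, |c n| ≤ |d (σ n)|) :
    lpNorm ε p S c ≤ lpNorm ε p T d := by
  rcases eq_or_ne p ∞ with rfl | hp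
  · simp only [lpNorm_top, NNReal.coe_le_coe]
    refine Finset.sup_le fun n hn => ?_
    refine le_trans ?_ (Finset.le_sup (f := fun n => ‖d n‖₊) (hST n hn))
    rw [← NNReal.coe_le_coe]
    simpa using hcd n hn
  · simp only [lpNorm_of_ne_top hp]
    gcongr
    calc ∑ n ∈ S, |c n| ^ p.toReal ≤ ∑ n ∈ S, |d (σ n)| ^ p.toReal := by
          exact Finset.sum_le_sum fun n hn =>
            Real.rpow_le_rpow (abs_nonneg _) (hcd n hn) ENNReal.toReal_nonneg
      _ = ∑ n ∈ S.image σ, |d n| ^ p.toReal :=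
          (Finset.sum_image (f := fun n => |d n| ^ p.toReal) hσ).symm
      _ ≤ ∑ n ∈ T, |d n| ^ p.toReal :=
          Finset.sum_le_sum_of_subset_of_nonneg (Finset.image_subset_iff.2 hST)
            fun _ _ _ => by positivity

/-- Hölder's inequality for the weighted norms. -/
lemma sum_abs_mul_le_lpNorm (hε : 0 < ε) (hp : 1 ≤ p) (hq : 1 ≤ q) (hpq : 1 / p + 1 / q = 1)
    (S : Finset ℤ) (c v : ℤ → ℝ) :
    ε * ∑ n ∈ S, |c n| * |v n| ≤ lpNorm ε p S c * lpNorm ε q S v := by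
  rcases eq_or_ne p ∞ with rfl | hpt
  · obtain rfl : q = 1 := by simpa using hpq
    rw [lpNorm_one, mul_left_comm]
    refine mul_le_mul_of_nonneg_left ?_ hε.le
    rw [Finset.mul_sum]
    gcongr with n hn
    exact abs_le_lpNorm_top hn c
  rcases eq_or_ne q ∞ with rfl | hqt
  · obtain rfl : p = 1 := by simpa using hpq
    rw [lpNorm_one, mul_assoc, Finset.sum_mul]
    gcongr with n hn
    exact abs_le_lpNorm_top hn v
  have hp0 : 0 < p.toReal := ENNReal.toReal_pos (by positivity) hpt
  have hq0 : 0 < q.toReal := ENNReal.toReal_pos (by positivity) hqt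
  have hsum : p.toReal⁻¹ + q.toReal⁻¹ = 1 := by
    have h := congrArg ENNReal.toReal hpq
    rw [ENNReal.toReal_add (by simp; positivity) (by simp; positivity)] at h
    simpa using h
  have hH : p.toReal.HolderConjugate q.toReal := ⟨by simpa using hsum, hp0, hq0⟩
  have key := Real.inner_le_Lp_mul_Lq S (fun n => |c n|) (fun n => |v n|) hH
  simp only [abs_abs] at key
  rw [lpNorm_of_ne_top hpt, lpNorm_of_ne_top hqt, mul_mul_mul_comm, ← Real.rpow_add hε,
    one_div, one_div, hsum, Real.rpow_one, ← one_div, ← one_div]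
  gcongr

lemma lpNorm_sq (hε : 0 < ε) (hp : 1 ≤ p) (S : Finset ℤ) (c : ℤ → ℝ) :
    lpNorm ε p S (fun n => c n ^ 2) = lpNorm ε (2 * p) S c ^ 2 := by
  rcases eq_or_ne p ∞ with rfl | hpt
  · rw [ENNReal.mul_top (by simp), lpNorm_top, lpNorm_top, ← NNReal.coe_pow, NNReal.coe_inj]
    have h := Finset.apply_sup_eq_sup_comp_of_linearOrder (s := S) (f := fun n => ‖c n‖₊)
      (fun x : ℝ≥0 => x ^ 2) (fun _ _ h => pow_le_pow_left₀ zero_le h 2) (by simp)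
    rw [h]
    simp [Function.comp_def]
  have hp0 : 0 < p.toReal := ENNReal.toReal_pos (by positivity) hpt
  rw [lpNorm_of_ne_top hpt, lpNorm_of_ne_top (ENNReal.mul_ne_top (by simp) hpt), mul_pow,
    ENNReal.toReal_mul, ← Real.rpow_mul_natCast hε.le,
    ← Real.rpow_mul_natCast (Finset.sum_nonneg fun _ _ => by positivity)]
  have h1 : 1 / ((2 : ℝ≥0∞).toReal * p.toReal) * ((2 : ℕ) : ℝ) = 1 / p.toReal := by
    simp
  rw [h1]
  congr 2
  refine Finset.sum_congr rfl fun n _ => ?_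
  rw [Real.rpow_mul (abs_nonneg _)]
  simp

lemma mul_abs_le_lpNorm (hε : 0 < ε) (hp : 1 ≤ p) (hq : 1 ≤ q) (hpq : 1 / p + 1 / q = 1)
    {S : Finset ℤ} {n : ℤ} (hn : n ∈ S) (v : ℤ → ℝ) :
    ε * |v n| ≤ ε ^ (1 / p).toReal * lpNorm ε q S v := by
  have h := sum_abs_mul_le_lpNorm hε hp hq hpq {n} (fun _ => 1) v
  have h1 : lpNorm ε p {n} (fun _ => 1) = ε ^ (1 / p).toReal := by
    rcases eq_or_ne p ∞ with rfl | hpt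
    · simp [lpNorm_top]
    · simp [lpNorm_of_ne_top hpt]
  rw [h1] at h
  simp only [abs_one, one_mul, Finset.sum_singleton] at h
  refine h.trans ?_
  gcongr
  exact lpNorm_le_of_injOn hε.le id (Set.injOn_id _) (by simpa using hn) (by simp)

/-- Hölder's inequality with the second factor measured, after reindexing, on a larger set. -/
lemma sum_abs_mul_comp_le_lpNorm (hε : 0 < ε) (hp : 1 ≤ p) (hq : 1 ≤ q)
    (hpq : 1 / p + 1 / q = 1) {S T : Finset ℤ} (σ : ℤ → ℤ) (hσ : Set.InjOn σ S)
    (hST : ∀ n ∈ S, σ n ∈ T) (c v : ℤ → ℝ) :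
    ε * ∑ n ∈ S, |c n| * |v (σ n)| ≤ lpNorm ε p S c * lpNorm ε q T v := by
  refine (sum_abs_mul_le_lpNorm hε hp hq hpq S c (fun n => v (σ n))).trans ?_
  gcongr
  · exact lpNorm_nonneg hε.le _ _
  · exact lpNorm_le_of_injOn hε.le σ hσ hST fun _ _ => le_rfl

end LpNorm

section Calculus

variable {F : ℝ → ℝ}

/-- Second-order Taylor bound for a function with Lipschitz derivative. -/
lemma abs_sub_sub_deriv_mul_le {m : ℝ} (hF : Differentiable ℝ F)
    (hm : ∀ s t : ℝ, |deriv F s - deriv F t| ≤ m * |s - t|) (x h : ℝ) :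
    |F (x + h) - F x - deriv F x * h| ≤ m * h ^ 2 / 2 := by
  have hd : ∀ t : ℝ, HasDerivAt (fun t => F (x + t * h) - F x - deriv F x * (t * h))
      (deriv F (x + t * h) * h - deriv F x * h) t := fun t => by
    have h1 : HasDerivAt (fun t : ℝ => t * h) h t := by
      simpa using (hasDerivAt_id t).mul_const h
    exact (((hF _).hasDerivAt.comp t (h1.const_add x)).sub_const _).sub (h1.const_mul _)
  have hB : ∀ t : ℝ, HasDerivAt (fun t => m * h ^ 2 / 2 * t ^ 2) (m * h ^ 2 * t) t := fun t => by
    exact ((hasDerivAt_pow 2 t).const_mul (m * h ^ 2 / 2)).congr_deriv (by norm_num; ring)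
  have := image_norm_le_of_norm_deriv_right_le_deriv_boundary (a := 0) (b := 1)
    (fun t _ => (hd t).continuousAt.continuousWithinAt)
    (fun t _ => (hd t).hasDerivWithinAt) (by simp) hB (fun t ht => by
      rw [← sub_mul, Real.norm_eq_abs, abs_mul]
      calc _ ≤ m * |x + t * h - x| * |h| := by gcongr; exact hm _ _
        _ = m * h ^ 2 * t := by
          rw [add_sub_cancel_left, abs_mul, abs_of_nonneg ht.1, ← sq_abs h]; ring)
    (Set.right_mem_Icc.2 zero_le_one)
  simpa using this

lemma abs_two_mul_sub_sub_le {m' m'' : ℝ} (hF : Differentiable ℝ F) (hm'0 : 0 ≤ m')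
    (hm' : ∀ s t : ℝ, |F s - F t| ≤ m' * |s - t|)
    (hm'' : ∀ s t : ℝ, |deriv F s - deriv F t| ≤ m'' * |s - t|) (x h k : ℝ) :
    |2 * F x - F (x + h) - F (x - k)| ≤ m' * |h - k| + m'' * (h ^ 2 + k ^ 2) / 2 := by
  have hd : |deriv F x| ≤ m' :=
    norm_deriv_le_of_lip' (f := F) (x₀ := x) hm'0 (Filter.Eventually.of_forall fun t => hm' t x)
  have h1 := abs_sub_sub_deriv_mul_le hF hm'' x h
  have h2 := abs_sub_sub_deriv_mul_le hF hm'' x (-k)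
  have h3 : |deriv F x * (h - k)| ≤ m' * |h - k| := by rw [abs_mul]; gcongr
  rw [← sub_eq_add_neg] at h2
  rw [abs_le] at *
  constructor <;> linarith [h1.1, h1.2, h2.1, h2.2, h3.1, h3.2]

end Calculus

lemma sum_Icc_comp_add_one (f : ℤ → ℝ) {a b : ℤ} (h : a ≤ b + 1) :
    ∑ n ∈ Finset.Icc a b, f (n + 1) = ∑ n ∈ Finset.Icc a b, f n + f (b + 1) - f a := by
  have h1 : ∑ n ∈ Finset.Icc a b, f (n + 1) = ∑ n ∈ Finset.Icc (a + 1) (b + 1), f n := by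
    rw [← Finset.map_add_right_Icc, Finset.sum_map]; rfl
  have h2 : Finset.Icc a (b + 1) = insert (b + 1) (Finset.Icc a b) := by ext; simp; omega
  have h3 : Finset.Icc a (b + 1) = insert a (Finset.Icc (a + 1) (b + 1)) := by ext; simp; omega
  have h4 := congrArg (fun S : Finset ℤ => ∑ n ∈ S, f n) (h2.symm.trans h3)
  rw [Finset.sum_insert (by simp), Finset.sum_insert (by simp)] at h4
  linarith

lemma sum_Icc_comp_sub_one (f : ℤ → ℝ) {a b : ℤ} (h : a ≤ b + 1) :
    ∑ n ∈ Finset.Icc a b, f (n - 1) = ∑ n ∈ Finset.Icc a b, f n + f (a - 1) - f b := by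
  have := sum_Icc_comp_add_one (fun n => f (n - 1)) h
  simp only [add_sub_cancel_right] at this
  linarith

lemma sum_rng_comp_add_one {N : ℕ} {f : ℤ → ℝ} (hf : ∀ n, f (n + 2 * N) = f n) :
    ∑ n ∈ rng N, f (n + 1) = ∑ n ∈ rng N, f n := by
  rw [rng, sum_Icc_comp_add_one _ (by omega), ← hf (-N + 1)]
  ring_nf

section Periodic

variable {N : ℕ} {ε : ℝ} {w : ℤ → ℝ}

lemma d1_add_period {c : ℝ} (hw : ∀ n, w (n + 2 * N) = w n + c) (n : ℤ) :
    d1 ε w (n + 2 * N) = d1 ε w n := by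
  unfold d1
  rw [show n + 2 * (N : ℤ) - 1 = (n - 1) + 2 * N by ring, hw, hw]
  ring

lemma d2_add_period (hw : ∀ n, d1 ε w (n + 2 * N) = d1 ε w n) (n : ℤ) :
    d2 ε w (n + 2 * N) = d2 ε w n := by
  unfold d2
  rw [show n + 2 * (N : ℤ) + 1 = (n + 1) + 2 * N by ring, hw, hw]

end Periodic

lemma d1_add_smul (ε : ℝ) (y u : ℤ → ℝ) (t : ℝ) (n : ℤ) :
    d1 ε (fun n => y n + t * u n) n = d1 ε y n + t * d1 ε u n := by
  unfold d1
  ring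

lemma Nc'_subset_rng (N K : ℕ) : Nc' N K ⊆ rng N := by
  intro n
  simp only [Nc', rng, Finset.mem_union, Finset.mem_Icc]
  omega

/-- The first variation of the quasicontinuum energy minus that of the atomistic energy. -/
lemma hasDerivAt_Eqce_sub_Ea1 (N K : ℕ) (ε : ℝ) {φ1 φ2 : ℝ → ℝ} (h1 : Differentiable ℝ φ1)
    (h2 : Differentiable ℝ φ2) (y u : ℤ → ℝ) {f g h : ℤ → ℝ}
    (hf : ∀ n, f n = deriv φ1 (d1 ε y n) * d1 ε u n)
    (hg : ∀ n, g n = deriv φ2 (2 * d1 ε y n) * d1 ε u n)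
    (hh : ∀ n, h n = deriv φ2 (d1 ε y n + d1 ε y (n + 1)) * (d1 ε u n + d1 ε u (n + 1))) :
    HasDerivAt (fun t : ℝ => Eqce N K ε φ1 φ2 (fun n => y n + t * u n)
        - Ea1 N ε φ1 φ2 (fun n => y n + t * u n))
      (ε * ∑ n ∈ Na K, (f n + f (n + 1) + h (n - 1) + h (n + 1)) / 2
        + ε * ∑ n ∈ Nc N K, (f n + f (n + 1) + 2 * g n + 2 * g (n + 1)) / 2
        - (ε * ∑ n ∈ rng N, f n + ε * ∑ n ∈ rng N, h n)) 0 := by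
  have hlin : ∀ a b : ℝ, HasDerivAt (fun t : ℝ => a + t * b) b 0 := fun a b => by
    simpa using ((hasDerivAt_id (0 : ℝ)).mul_const b).const_add a
  have hcomp : ∀ {φ : ℝ → ℝ} {r : ℝ → ℝ} {a b : ℝ}, Differentiable ℝ φ →
      HasDerivAt r b 0 → r 0 = a → HasDerivAt (fun t => φ (r t)) (deriv φ a * b) 0 := by
    rintro φ r a b hφ hr rfl
    exact (hφ (r 0)).hasDerivAt.comp (0 : ℝ) hr
  have Hf : ∀ n, HasDerivAt (fun t : ℝ => φ1 (d1 ε y n + t * d1 ε u n)) (f n) 0 := fun n => by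
    rw [hf]
    exact hcomp h1 (hlin _ _) (by simp)
  have Hg : ∀ n, HasDerivAt (fun t : ℝ => φ2 (2 * (d1 ε y n + t * d1 ε u n))) (2 * g n) 0 :=
    fun n => by
      rw [hg]
      exact (hcomp (a := 2 * d1 ε y n) h2 ((hlin _ _).const_mul 2) (by simp)).congr_deriv (by ring)
  have Hh : ∀ n m, m = n + 1 → HasDerivAt (fun t : ℝ => φ2 ((d1 ε y n + t * d1 ε u n)
      + (d1 ε y m + t * d1 ε u m))) (h n) 0 := by
    rintro n m rfl
    rw [hh]
    exact hcomp h2 ((hlin _ _).add (hlin _ _)) (by simp)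
  simp only [Eqce, Ea1, d1_add_smul]
  refine ((HasDerivAt.fun_sum fun n _ => ?_).const_mul ε |>.add
    ((HasDerivAt.fun_sum fun n _ => ?_).const_mul ε)).sub
    (((HasDerivAt.fun_sum fun n _ => ?_).const_mul ε).add
      ((HasDerivAt.fun_sum fun n _ => ?_).const_mul ε))
  · exact ((((Hf n).add (Hf (n + 1))).add (Hh (n - 1) n (by ring))).add
      (Hh (n + 1) (n + 2) (by ring))).div_const 2
  · exact ((((Hf n).add (Hf (n + 1))).add (Hg n)).add (Hg (n + 1))).div_const 2
  · exact Hf n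
  · exact Hh n _ rfl

/-- Summation by parts: the stress difference splits into a continuum part and interface terms. -/
lemma sum_stress_difference {N K : ℕ} (hK : K + 2 ≤ N) {f g P Q : ℤ → ℝ}
    (hf : ∀ n, f (n + 2 * N) = f n) (hg : ∀ n, g (n + 2 * N) = g n)
    (hQ : ∀ n, Q (n + 2 * N) = Q n) :
    ∑ n ∈ Na K, (f n + f (n + 1) + (P (n - 1) + Q (n - 1)) + (P (n + 1) + Q (n + 1))) / 2
        + ∑ n ∈ Nc N K, (f n + f (n + 1) + 2 * g n + 2 * g (n + 1)) / 2
        - (∑ n ∈ rng N, f n + ∑ n ∈ rng N, (P n + Q n))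
      = ∑ n ∈ Nc' N K, (2 * g n - P n - Q (n - 1))
        + (g (-K) + g (K + 1)
          + (P (-K - 1) - Q (-K - 1) - (P K + Q K) - (P (-K) + Q (-K))
            + Q (K + 1) - P (K + 1)) / 2) := by
  have hNa : Na K ⊆ rng N := by
    intro n
    simp only [Na, rng, Finset.mem_Icc]
    omega
  have hNc' : Nc' N K = rng N \ Finset.Icc (-(K : ℤ)) (K + 1) := by
    ext n
    simp only [Nc', rng, Finset.mem_union, Finset.mem_sdiff, Finset.mem_Icc]
    omega
  have hsub : Finset.Icc (-(K : ℤ)) (K + 1) ⊆ rng N := by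
    intro n
    simp only [rng, Finset.mem_Icc]
    omega
  have hlast : ∀ r : ℤ → ℝ,
      ∑ n ∈ Finset.Icc (-(K : ℤ)) (K + 1), r n = ∑ n ∈ Na K, r n + r (K + 1) := fun r => by
    rw [show Finset.Icc (-(K : ℤ)) (K + 1) = insert ((K : ℤ) + 1) (Na K) by
      ext; simp [Na]; omega, Finset.sum_insert (by simp [Na]), add_comm]
  have hup : ∀ r : ℤ → ℝ, ∑ n ∈ Na K, r (n + 1) = ∑ n ∈ Na K, r n + r (K + 1) - r (-K) :=
    fun r => sum_Icc_comp_add_one r (by omega)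
  have hdn : ∀ r : ℤ → ℝ, ∑ n ∈ Na K, r (n - 1) = ∑ n ∈ Na K, r n + r (-K - 1) - r K :=
    fun r => sum_Icc_comp_sub_one r (by omega)
  have hQ' : ∑ n ∈ rng N, Q (n - 1) = ∑ n ∈ rng N, Q n := by
    have := sum_rng_comp_add_one (f := fun n => Q (n - 1)) (N := N) fun n => by
      rw [show n + 2 * (N : ℤ) - 1 = (n - 1) + 2 * N by ring, hQ]
    simpa using this.symm
  have hNc : ∀ r : ℤ → ℝ, ∑ n ∈ Nc N K, r n = ∑ n ∈ rng N, r n - ∑ n ∈ Na K, r n :=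
    fun r => Finset.sum_sdiff_eq_sub hNa
  have hC : ∀ r : ℤ → ℝ, ∑ n ∈ Nc' N K, r n
      = ∑ n ∈ rng N, r n - ∑ n ∈ Finset.Icc (-(K : ℤ)) (K + 1), r n := fun r => by
    rw [hNc', Finset.sum_sdiff_eq_sub hsub]
  rw [hNc, hC, hlast]
  simp only [← Finset.sum_div, Finset.sum_add_distrib, Finset.sum_sub_distrib, ← Finset.mul_sum,
    hup, hdn, hQ', sum_rng_comp_add_one hf, sum_rng_comp_add_one hg, add_sub_cancel_right]
  ring

/-- The interface terms split into ghost forces and differences of neighbouring stresses. -/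
lemma abs_interface_le {F : ℝ → ℝ} {m : ℝ} (hm : ∀ s t : ℝ, |F s - F t| ≤ m * |s - t|)
    (a v : ℤ → ℝ) (k : ℤ) {g P Q : ℤ → ℝ} (hg : ∀ n, g n = F (2 * a n) * v n)
    (hP : ∀ n, P n = F (a n + a (n + 1)) * v n)
    (hQ : ∀ n, Q n = F (a n + a (n + 1)) * v (n + 1))
    {X : ℤ → ℝ} (hX : ∀ n, X n = m * |a (n + 1) - a n| * (|v n| + |v (n + 1)|)) :
    |g (-k) + g (k + 1) + (P (-k - 1) - Q (-k - 1) - (P k + Q k) - (P (-k) + Q (-k))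
        + Q (k + 1) - P (k + 1)) / 2|
      ≤ (X (-k - 1) + X (-k) + X k + X (k + 1)) / 2
        + (|F (2 * a (-k - 1))| * |v (-k - 1)| + |F (2 * a (-k + 1))| * |v (-k + 1)|
          + |F (2 * a k)| * |v k| + |F (2 * a (k + 2))| * |v (k + 2)|) / 2 := by
  have hl : ∀ n, |P n - g n| ≤ m * |a (n + 1) - a n| * |v n| := fun n => by
    rw [hP, hg, ← sub_mul, abs_mul]
    gcongr
    refine (hm _ _).trans_eq ?_
    ring_nf
  have hr : ∀ n, |Q n - g (n + 1)| ≤ m * |a (n + 1) - a n| * |v (n + 1)| := fun n => by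
    rw [hQ, hg, ← sub_mul, abs_mul]
    gcongr
    refine (hm _ _).trans_eq ?_
    rw [← abs_neg]
    ring_nf
  have hgabs : ∀ n, |g n| = |F (2 * a n)| * |v n| := fun n => by rw [hg, abs_mul]
  have e1 : -k - 1 + 1 = -k := by ring
  have e2 : k + 1 + 1 = k + 2 := by ring
  have l1 := abs_le.1 (hl (-k - 1))
  have l2 := abs_le.1 (hl (-k))
  have l3 := abs_le.1 (hl k)
  have l4 := abs_le.1 (hl (k + 1))
  have r1 := abs_le.1 (hr (-k - 1))
  have r2 := abs_le.1 (hr (-k))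
  have r3 := abs_le.1 (hr k)
  have r4 := abs_le.1 (hr (k + 1))
  have g1 := abs_le.1 (hgabs (-k - 1)).le
  have g2 := abs_le.1 (hgabs (-k + 1)).le
  have g3 := abs_le.1 (hgabs k).le
  have g4 := abs_le.1 (hgabs (k + 2)).le
  simp only [hX, mul_add]
  simp only [e1, e2] at *
  rw [abs_le]
  constructor <;> linarith [l1.1, l1.2, l2.1, l2.2, l3.1, l3.2, l4.1, l4.2, r1.1, r1.2, r2.1,
    r2.2, r3.1, r3.2, r4.1, r4.2, g1.1, g1.2, g2.1, g2.2, g3.1, g3.2, g4.1, g4.2]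

lemma abs_d1_sub {ε : ℝ} (hε : 0 < ε) (y : ℤ → ℝ) (n : ℤ) :
    |d1 ε y (n + 1) - d1 ε y n| = ε * |d2 ε y n| := by
  rw [d2, abs_div, abs_of_pos hε]
  field_simp

/-- Pointwise second-order consistency of the local continuum stress. -/
lemma abs_continuum_stress_le {F : ℝ → ℝ} {m' m'' ε : ℝ} (hε : 0 < ε) (hF : Differentiable ℝ F)
    (hm'0 : 0 ≤ m') (hm' : ∀ s t : ℝ, |F s - F t| ≤ m' * |s - t|)
    (hm'' : ∀ s t : ℝ, |deriv F s - deriv F t| ≤ m'' * |s - t|) (y : ℤ → ℝ) (n : ℤ) :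
    |2 * F (2 * d1 ε y n) - F (d1 ε y n + d1 ε y (n + 1)) - F (d1 ε y (n - 1) + d1 ε y n)|
      ≤ ε ^ 2 * m' * |d3 ε y n|
        + ε ^ 2 * m'' * (d2 ε y n ^ 2 + d2 ε y (n - 1) ^ 2) / 2 := by
  have h := abs_two_mul_sub_sub_le hF hm'0 hm' hm'' (2 * d1 ε y n)
    (d1 ε y (n + 1) - d1 ε y n) (d1 ε y n - d1 ε y (n - 1))
  rw [show 2 * d1 ε y n + (d1 ε y (n + 1) - d1 ε y n) = d1 ε y n + d1 ε y (n + 1) by ring,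
    show 2 * d1 ε y n - (d1 ε y n - d1 ε y (n - 1)) = d1 ε y (n - 1) + d1 ε y n by ring] at h
  refine h.trans_eq ?_
  have h3 : ε ^ 2 * |d3 ε y n|
      = |d1 ε y (n + 1) - d1 ε y n - (d1 ε y n - d1 ε y (n - 1))| := by
    rw [d3, abs_div, abs_of_pos (by positivity : 0 < ε ^ 2), mul_div_cancel₀ _ (by positivity)]
    ring_nf
  rw [← h3, d2, d2, sub_add_cancel]
  field_simp

/-- The continuum part of the consistency error. -/
lemma sum_continuum_le {N K : ℕ} {ε m' m'' : ℝ} {p q : ℝ≥0∞} (hε : 0 < ε) (hK : K + 2 ≤ N)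
    (hp : 1 ≤ p) (hq : 1 ≤ q) (hpq : 1 / p + 1 / q = 1) (hm' : 0 ≤ m') (hm'' : 0 ≤ m'')
    {y : ℤ → ℝ} (hy : ∀ n, d2 ε y (n + 2 * N) = d2 ε y n) (v : ℤ → ℝ) {C : ℤ → ℝ}
    (hC : ∀ n, |C n| ≤ ε ^ 2 * m' * |d3 ε y n|
        + ε ^ 2 * m'' * (d2 ε y n ^ 2 + d2 ε y (n - 1) ^ 2) / 2) :
    ε * |∑ n ∈ Nc' N K, C n * v n|
      ≤ (ε ^ 2 * m' * lpNorm ε p (Nc' N K) (d3 ε y)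
        + ε ^ 2 * m'' * lpNorm ε (2 * p) (Nc N K ∪ {-(K : ℤ), (K : ℤ)}) (d2 ε y) ^ 2)
        * lpNorm ε q (rng N) v := by
  set S := Nc N K ∪ {-(K : ℤ), (K : ℤ)} with hS
  have hmem : ∀ n ∈ Nc' N K, n ∈ S ∧ n - 1 + (if n = -(N : ℤ) + 1 then 2 * (N : ℤ) else 0) ∈ S := by
    intro n
    simp only [hS, Nc, Na, Nc', rng, Finset.mem_union, Finset.mem_sdiff, Finset.mem_insert,
      Finset.mem_singleton, Finset.mem_Icc]
    split_ifs <;> omega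
  have hle : ∀ c : ℤ → ℝ, ε * ∑ n ∈ Nc' N K, |c n| * |v n|
      ≤ lpNorm ε p (Nc' N K) c * lpNorm ε q (rng N) v := fun c =>
    sum_abs_mul_comp_le_lpNorm hε hp hq hpq id (Set.injOn_id _)
      (fun n hn => Nc'_subset_rng N K hn) c v
  have hV := lpNorm_nonneg (p := q) hε.le (rng N) v
  have b3 := hle (d3 ε y)
  have b1 : ε * ∑ n ∈ Nc' N K, |d2 ε y n ^ 2| * |v n|
      ≤ lpNorm ε (2 * p) S (d2 ε y) ^ 2 * lpNorm ε q (rng N) v := by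
    rw [← lpNorm_sq hε hp]
    refine (hle fun n => d2 ε y n ^ 2).trans (mul_le_mul_of_nonneg_right ?_ hV)
    exact lpNorm_le_of_injOn hε.le id (Set.injOn_id _) (fun n hn => (hmem n hn).1)
      fun _ _ => le_rfl
  have b2 : ε * ∑ n ∈ Nc' N K, |d2 ε y (n - 1) ^ 2| * |v n|
      ≤ lpNorm ε (2 * p) S (d2 ε y) ^ 2 * lpNorm ε q (rng N) v := by
    rw [← lpNorm_sq hε hp]
    refine (hle fun n => d2 ε y (n - 1) ^ 2).trans (mul_le_mul_of_nonneg_right ?_ hV)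
    refine lpNorm_le_of_injOn hε.le
      (fun n => n - 1 + (if n = -(N : ℤ) + 1 then 2 * (N : ℤ) else 0)) ?_
      (fun n hn => (hmem n hn).2) fun n _ => ?_
    · intro n hn k hk
      have h1 := Nc'_subset_rng N K hn
      have h2 := Nc'_subset_rng N K hk
      simp only [rng, Finset.mem_Icc] at h1 h2
      dsimp only
      split_ifs <;> omega
    · split_ifs
      · simp [hy]
      · simp
  calc ε * |∑ n ∈ Nc' N K, C n * v n|
      ≤ ε * ∑ n ∈ Nc' N K, (ε ^ 2 * m' * |d3 ε y n|
        + ε ^ 2 * m'' * (d2 ε y n ^ 2 + d2 ε y (n - 1) ^ 2) / 2) * |v n| := by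
        gcongr
        refine (Finset.abs_sum_le_sum_abs _ _).trans (Finset.sum_le_sum fun n _ => ?_)
        rw [abs_mul]
        gcongr
        exact hC n
    _ = ε ^ 2 * m' * (ε * ∑ n ∈ Nc' N K, |d3 ε y n| * |v n|)
        + ε ^ 2 * m'' / 2 * (ε * ∑ n ∈ Nc' N K, |d2 ε y n ^ 2| * |v n|
          + ε * ∑ n ∈ Nc' N K, |d2 ε y (n - 1) ^ 2| * |v n|) := by
        simp only [Finset.mul_sum, ← Finset.sum_add_distrib, abs_sq]
        exact Finset.sum_congr rfl fun n _ => by ring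
    _ ≤ ε ^ 2 * m' * (lpNorm ε p (Nc' N K) (d3 ε y) * lpNorm ε q (rng N) v)
        + ε ^ 2 * m'' / 2 * (lpNorm ε (2 * p) S (d2 ε y) ^ 2 * lpNorm ε q (rng N) v
          + lpNorm ε (2 * p) S (d2 ε y) ^ 2 * lpNorm ε q (rng N) v) := by
        gcongr
    _ = _ := by ring

/-- The contribution of the stress differences at the interface. -/
lemma sum_interface_le {N K : ℕ} {ε : ℝ} {p q : ℝ≥0∞} (hε : 0 < ε) (hK1 : 1 ≤ K)
    (hK : K + 2 ≤ N) (hp : 1 ≤ p) (hq : 1 ≤ q) (hpq : 1 / p + 1 / q = 1) (c v : ℤ → ℝ) {X : ℤ → ℝ}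
    (hX : ∀ n, X n = |c n| * (|v n| + |v (n + 1)|)) :
    ε * ((X (-K - 1) + X (-K) + X K + X (K + 1)) / 2)
      ≤ lpNorm ε p {-(K : ℤ) - 1, -(K : ℤ), (K : ℤ), (K : ℤ) + 1} c * lpNorm ε q (rng N) v := by
  set S : Finset ℤ := {-(K : ℤ) - 1, -(K : ℤ), (K : ℤ), (K : ℤ) + 1} with hS
  have hmem : ∀ n ∈ S, n ∈ rng N ∧ n + 1 ∈ rng N := by
    intro n
    simp only [hS, rng, Finset.mem_insert, Finset.mem_singleton, Finset.mem_Icc]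
    omega
  have h1 := sum_abs_mul_comp_le_lpNorm hε hp hq hpq id (Set.injOn_id _)
    (fun n hn => (hmem n hn).1) c v
  have h2 := sum_abs_mul_comp_le_lpNorm hε hp hq hpq (· + 1) (add_left_injective 1).injOn
    (fun n hn => (hmem n hn).2) c v
  have hsum : X (-K - 1) + X (-K) + X K + X (K + 1) = ∑ n ∈ S, X n := by
    rw [hS, Finset.sum_insert (by simp; omega), Finset.sum_insert (by simp; omega),
      Finset.sum_insert (by simp), Finset.sum_singleton]
    ring
  rw [hsum]
  simp only [hX, mul_add, Finset.sum_add_distrib]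
  simp only [id] at h1
  linarith

/-- The contribution of the ghost forces. -/
lemma ghost_le {N K : ℕ} {ε : ℝ} {p q : ℝ≥0∞} (hε : 0 < ε)
    (hK : K + 2 ≤ N) (hp : 1 ≤ p) (hq : 1 ≤ q) (hpq : 1 / p + 1 / q = 1) (v : ℤ → ℝ)
    {G₁ G₂ G₃ G₄ : ℝ} (h₁ : 0 ≤ G₁) (h₂ : 0 ≤ G₂) (h₃ : 0 ≤ G₃) (h₄ : 0 ≤ G₄) :
    ε * ((G₁ * |v (-K - 1)| + G₂ * |v (-K + 1)| + G₃ * |v K| + G₄ * |v (K + 2)|) / 2)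
      ≤ ε ^ (1 / p).toReal * ((G₁ + G₂ + G₃ + G₄) / 2) * lpNorm ε q (rng N) v := by
  have hb : ∀ {n : ℤ} {G : ℝ}, 0 ≤ G → -(N : ℤ) + 1 ≤ n → n ≤ N →
      G * (ε * |v n|) ≤ G * (ε ^ (1 / p).toReal * lpNorm ε q (rng N) v) := fun hG hl hr =>
    mul_le_mul_of_nonneg_left
      (mul_abs_le_lpNorm hε hp hq hpq (by simp [rng, Finset.mem_Icc]; omega) v) hG
  have a1 := hb (n := -K - 1) h₁ (by omega) (by omega)
  have a2 := hb (n := -K + 1) h₂ (by omega) (by omega)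
  have a3 := hb (n := K) h₃ (by omega) (by omega)
  have a4 := hb (n := K + 2) h₄ (by omega) (by omega)
  linarith

/-- Consistency error of the QCE method. -/
theorem stmt_5
    (N K : ℕ) (hN : 1 ≤ N) (hK1 : 1 ≤ K) (hK2 : K + 2 ≤ N)
    (φ1 φ2 : ℝ → ℝ) (hφ1 : ContDiff ℝ 1 φ1) (hφ2 : ContDiff ℝ 2 φ2)
    (m2' m2'' : ℝ)
    (hm2' : ∀ s t : ℝ, |deriv φ2 s - deriv φ2 t| ≤ m2' * |s - t|)
    (hm2'' : ∀ s t : ℝ, |deriv (deriv φ2) s - deriv (deriv φ2) t| ≤ m2'' * |s - t|)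
    (p q : ℝ≥0∞) (hp : 1 ≤ p) (hq : 1 ≤ q) (hpq : 1 / p + 1 / q = 1)
    (A : ℝ) (y : ℤ → ℝ)
    (hy : ∀ n : ℤ, y (n + 2 * N) = y n + A * (1 / (N : ℝ)) * (2 * N))
    (u : ℤ → ℝ) (hu : ∀ n : ℤ, u (n + 2 * N) = u n)
    (D : ℝ)
    (hD : HasDerivAt (fun t : ℝ =>
        Eqce N K (1 / (N : ℝ)) φ1 φ2 (fun n => y n + t * u n)
          - Ea1 N (1 / (N : ℝ)) φ1 φ2 (fun n => y n + t * u n)) D 0) :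
    |D| ≤ ((1 / (N : ℝ)) ^ (1 / p).toReal
          * ((|deriv φ2 (2 * d1 (1 / (N : ℝ)) y (-(K : ℤ) - 1))|
              + |deriv φ2 (2 * d1 (1 / (N : ℝ)) y (-(K : ℤ) + 1))|
              + |deriv φ2 (2 * d1 (1 / (N : ℝ)) y (K : ℤ))|
              + |deriv φ2 (2 * d1 (1 / (N : ℝ)) y ((K : ℤ) + 2))|) / 2)
        + (1 / (N : ℝ)) * m2'
            * lpNorm (1 / (N : ℝ)) p {-(K : ℤ) - 1, -(K : ℤ), (K : ℤ), (K : ℤ) + 1}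
                (d2 (1 / (N : ℝ)) y)
        + (1 / (N : ℝ)) ^ 2 * m2' * lpNorm (1 / (N : ℝ)) p (Nc' N K) (d3 (1 / (N : ℝ)) y)
        + (1 / (N : ℝ)) ^ 2 * m2''
            * lpNorm (1 / (N : ℝ)) (2 * p) (Nc N K ∪ {-(K : ℤ), (K : ℤ)})
                (d2 (1 / (N : ℝ)) y) ^ 2)
      * lpNorm (1 / (N : ℝ)) q (rng N) (d1 (1 / (N : ℝ)) u) := by
  have hε : (0 : ℝ) < 1 / (N : ℝ) := by positivity
  generalize (1 / (N : ℝ)) = ε at *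
  have hm2'0 : 0 ≤ m2' := by simpa using (abs_nonneg _).trans (hm2' 1 0)
  have hm2''0 : 0 ≤ m2'' := by simpa using (abs_nonneg _).trans (hm2'' 1 0)
  have hdy : ∀ n, d1 ε y (n + 2 * N) = d1 ε y n := d1_add_period hy
  have hdu : ∀ n, d1 ε u (n + 2 * N) = d1 ε u n := d1_add_period (c := 0) (by simpa using hu)
  have hdiff := hφ2.differentiable_deriv_two
  set F := deriv φ2 with hF
  set a := d1 ε y with ha
  set v := d1 ε u with hv
  have hshift : ∀ n : ℤ, n + 2 * (N : ℤ) + 1 = (n + 1) + 2 * N := fun n => by ring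
  have hDeq := hD.unique (hasDerivAt_Eqce_sub_Ea1 N K ε (hφ1.differentiable (by simp))
    (hφ2.differentiable (by simp)) y u (f := fun n => deriv φ1 (a n) * v n)
    (g := fun n => F (2 * a n) * v n)
    (h := fun n => F (a n + a (n + 1)) * v n + F (a n + a (n + 1)) * v (n + 1))
    (fun _ => rfl) (fun _ => rfl) fun _ => (mul_add _ _ _).symm)
  rw [← mul_add, ← mul_add, ← mul_sub, sum_stress_difference hK2
    (f := fun n => deriv φ1 (a n) * v n) (g := fun n => F (2 * a n) * v n)
    (P := fun n => F (a n + a (n + 1)) * v n) (Q := fun n => F (a n + a (n + 1)) * v (n + 1))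
    (fun n => by simp only [hdy, hdu]) (fun n => by simp only [hdy, hdu])
    (fun n => by simp only [hshift, hdy, hdu])] at hDeq
  have hB := abs_interface_le hm2' a v K (g := fun n => F (2 * a n) * v n)
    (P := fun n => F (a n + a (n + 1)) * v n) (Q := fun n => F (a n + a (n + 1)) * v (n + 1))
    (X := fun n => m2' * |a (n + 1) - a n| * (|v n| + |v (n + 1)|))
    (fun _ => rfl) (fun _ => rfl) (fun _ => rfl) (fun _ => rfl)
  have hC := sum_continuum_le hε hK2 hp hq hpq hm2'0 hm2''0 (d2_add_period hdy) v
    (abs_continuum_stress_le hε hdiff hm2'0 hm2' hm2'' y)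
  have hI := sum_interface_le hε hK1 hK2 hp hq hpq (d2 ε y) v (fun _ => rfl)
  have hG := ghost_le hε hK2 hp hq hpq v (abs_nonneg (F (2 * a (-K - 1))))
    (abs_nonneg (F (2 * a (-K + 1)))) (abs_nonneg (F (2 * a K))) (abs_nonneg (F (2 * a (K + 2))))
  have hCeq : ∑ n ∈ Nc' N K, (2 * (F (2 * a n) * v n) - F (a n + a (n + 1)) * v n
        - F (a (n - 1) + a (n - 1 + 1)) * v (n - 1 + 1))
      = ∑ n ∈ Nc' N K, (2 * F (2 * a n) - F (a n + a (n + 1)) - F (a (n - 1) + a n)) * v n :=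
    Finset.sum_congr rfl fun n _ => by
      rw [sub_add_cancel]
      ring
  rw [hDeq, abs_mul, abs_of_pos hε, hCeq]
  refine (mul_le_mul_of_nonneg_left ((abs_add_le _ _).trans (add_le_add_right hB _)) hε.le).trans ?_
  have hI' := mul_le_mul_of_nonneg_left hI (mul_nonneg hε.le hm2'0)
  simp only [ha, abs_d1_sub hε]
  simp only [ha] at hC hG
  linarith
end
end

section
/- (Ghost forces of the QCE method.) For every A ∈ ℝ, let y_A denote the homogeneous deformation (y_A)_n := Aεn. Then for every 2N-periodic displacement u ∈ 𝓤, δE_qce(y_A)[u] − δE_a(y_A)[u] = (ε/2) φ₂'(2A) ( u'_{−K−1} − u'_{−K+1} − u'_K + u'_{K+2} ), where u'_n := (u_n − u_{n−1})/ε. -/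
open scoped BigOperators

noncomputable section

theorem sum_Icc_int_telescope (g : ℤ → ℝ) {a b : ℤ} (hab : a ≤ b) :
    ∑ n ∈ Finset.Icc a b, (g (n + 1) - g n) = g (b + 1) - g a := by
  induction b, hab using Int.leInduction with
  | base => simp
  | succ b hb ih =>
    have hins : Finset.Icc a (b + 1) = insert (b + 1) (Finset.Icc a b) := by
      ext x
      simp only [Finset.mem_insert, Finset.mem_Icc]
      lia
    rw [hins, Finset.sum_insert (by simp), ih]
    ring

theorem d1_homogeneous_add {ε : ℝ} (hε : ε ≠ 0) (A t : ℝ) (u : ℤ → ℝ) (n : ℤ) :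
    d1 ε (fun n => A * (ε * n) + t * u n) n = A + t * d1 ε u n := by
  simp only [d1]
  push_cast
  field_simp
  ring

/-- Differences of a `2N`-periodic sequence sum to zero over any shifted period. -/
theorem sum_rng_d1_add {N : ℕ} (hN : 1 ≤ N) (ε : ℝ) {u : ℤ → ℝ}
    (hu : ∀ n : ℤ, u (n + 2 * N) = u n) (k : ℤ) :
    ∑ n ∈ rng N, d1 ε u (n + k) = 0 := by
  have h := sum_Icc_int_telescope (fun n => u (n + k - 1) / ε)
    (a := -(N : ℤ) + 1) (b := N) (by lia)
  have hp := hu (-(N : ℤ) + k)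
  rw [show -(N : ℤ) + k + 2 * N = N + k by ring] at hp
  calc ∑ n ∈ rng N, d1 ε u (n + k)
      = ∑ n ∈ Finset.Icc (-(N : ℤ) + 1) N,
          (u (n + 1 + k - 1) / ε - u (n + k - 1) / ε) := by
        refine Finset.sum_congr rfl fun n _ => ?_
        rw [d1, sub_div, show n + 1 + k - 1 = n + k by ring]
    _ = 0 := by
        rw [h, show (N : ℤ) + 1 + k - 1 = N + k by ring,
          show -(N : ℤ) + 1 + k - 1 = -(N : ℤ) + k by ring, hp, sub_self]

theorem hasDerivAt_comp_affine {φ : ℝ → ℝ} (hφ : ContDiff ℝ 1 φ) (c v : ℝ) :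
    HasDerivAt (fun t : ℝ => φ (c + t * v)) (deriv φ c * v) 0 := by
  have hl : HasDerivAt (fun t : ℝ => c + t * v) v 0 := by
    simpa using ((hasDerivAt_id (0 : ℝ)).mul_const v).const_add c
  have h := (hφ.differentiable one_ne_zero (c + 0 * v)).hasDerivAt.comp (0 : ℝ) hl
  simpa [Function.comp_def] using h

theorem hasDerivAt_Ea1_homogeneous (N : ℕ) {ε : ℝ} (hε : ε ≠ 0) {φ1 φ2 : ℝ → ℝ}
    (hφ1 : ContDiff ℝ 1 φ1) (hφ2 : ContDiff ℝ 1 φ2) (A : ℝ) (u : ℤ → ℝ) :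
    HasDerivAt (fun t : ℝ => Ea1 N ε φ1 φ2 (fun n => A * (ε * n) + t * u n))
      (ε * ∑ n ∈ rng N, deriv φ1 A * d1 ε u n
        + ε * ∑ n ∈ rng N, deriv φ2 (2 * A) * (d1 ε u n + d1 ε u (n + 1))) 0 := by
  simp only [Ea1, d1_homogeneous_add hε]
  have e (t a b : ℝ) : A + t * a + (A + t * b) = 2 * A + t * (a + b) := by ring
  simp only [e]
  exact ((HasDerivAt.fun_sum fun n _ => hasDerivAt_comp_affine hφ1 _ _).const_mul ε).add
    ((HasDerivAt.fun_sum fun n _ => hasDerivAt_comp_affine hφ2 _ _).const_mul ε)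

theorem hasDerivAt_Eqce_homogeneous (N K : ℕ) {ε : ℝ} (hε : ε ≠ 0) {φ1 φ2 : ℝ → ℝ}
    (hφ1 : ContDiff ℝ 1 φ1) (hφ2 : ContDiff ℝ 1 φ2) (A : ℝ) (u : ℤ → ℝ) :
    HasDerivAt (fun t : ℝ => Eqce N K ε φ1 φ2 (fun n => A * (ε * n) + t * u n))
      (ε * ∑ n ∈ Na K, (deriv φ1 A * d1 ε u n + deriv φ1 A * d1 ε u (n + 1)
          + deriv φ2 (2 * A) * (d1 ε u (n - 1) + d1 ε u n)
          + deriv φ2 (2 * A) * (d1 ε u (n + 1) + d1 ε u (n + 2))) / 2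
        + ε * ∑ n ∈ Nc N K, (deriv φ1 A * d1 ε u n + deriv φ1 A * d1 ε u (n + 1)
          + deriv φ2 (2 * A) * (2 * d1 ε u n)
          + deriv φ2 (2 * A) * (2 * d1 ε u (n + 1))) / 2) 0 := by
  simp only [Eqce, d1_homogeneous_add hε]
  have e (t a b : ℝ) : A + t * a + (A + t * b) = 2 * A + t * (a + b) := by ring
  have e' (t a : ℝ) : 2 * (A + t * a) = 2 * A + t * (2 * a) := by ring
  simp only [e, e']
  have h1 (v : ℝ) := hasDerivAt_comp_affine hφ1 A v
  have h2 (v : ℝ) := hasDerivAt_comp_affine hφ2 (2 * A) v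
  exact ((HasDerivAt.fun_sum fun n _ =>
      ((((h1 _).add (h1 _)).add (h2 _)).add (h2 _)).div_const 2).const_mul ε).add
    ((HasDerivAt.fun_sum fun n _ =>
      ((((h1 _).add (h1 _)).add (h2 _)).add (h2 _)).div_const 2).const_mul ε)

/-- Ghost forces of the QCE method: for the homogeneous deformation
`(y_A)_n = Aεn` and any `2N`-periodic displacement `u`,
`δE_qce(y_A)[u] − δE_a(y_A)[u] = (ε/2) φ₂'(2A) (u'_{−K−1} − u'_{−K+1} − u'_K + u'_{K+2})`. -/
theorem stmt_6
    (N K : ℕ) (hN : 1 ≤ N) (hK1 : 1 ≤ K) (hK2 : K + 2 ≤ N)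
    (φ1 φ2 : ℝ → ℝ) (hφ1 : ContDiff ℝ 1 φ1) (hφ2 : ContDiff ℝ 1 φ2)
    (A : ℝ) (u : ℤ → ℝ) (hu : ∀ n : ℤ, u (n + 2 * N) = u n) :
    HasDerivAt (fun t : ℝ =>
        Eqce N K (1 / (N : ℝ)) φ1 φ2 (fun n => A * ((1 / (N : ℝ)) * n) + t * u n)
          - Ea1 N (1 / (N : ℝ)) φ1 φ2 (fun n => A * ((1 / (N : ℝ)) * n) + t * u n))
      ((1 / (N : ℝ)) / 2 * deriv φ2 (2 * A)
        * (d1 (1 / (N : ℝ)) u (-(K : ℤ) - 1) - d1 (1 / (N : ℝ)) u (-(K : ℤ) + 1)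
            - d1 (1 / (N : ℝ)) u (K : ℤ) + d1 (1 / (N : ℝ)) u ((K : ℤ) + 2))) 0 := by
  have hε : (1 / (N : ℝ)) ≠ 0 := one_div_ne_zero (by positivity)
  refine ((hasDerivAt_Eqce_homogeneous N K hε hφ1 hφ2 A u).sub
    (hasDerivAt_Ea1_homogeneous N hε hφ1 hφ2 A u)).congr_deriv ?_
  generalize 1 / (N : ℝ) = ε
  have s0 : ∑ n ∈ rng N, d1 ε u n = 0 := by simpa using sum_rng_d1_add hN ε hu 0
  have s1 := sum_rng_d1_add hN ε hu 1
  have hsub : Na K ⊆ rng N := by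
    intro n
    simp only [Na, rng, Finset.mem_Icc]
    lia
  have c0 := Finset.sum_sdiff (f := fun n => d1 ε u n) hsub
  have c1 := Finset.sum_sdiff (f := fun n => d1 ε u (n + 1)) hsub
  have t0 := sum_Icc_int_telescope (fun n => d1 ε u (n - 1))
    (a := -(K : ℤ)) (b := K) (by lia)
  have t1 := sum_Icc_int_telescope (fun n => d1 ε u (n + 1))
    (a := -(K : ℤ)) (b := K) (by lia)
  simp only [add_sub_cancel_right, add_assoc, one_add_one_eq_two,
    Finset.sum_sub_distrib] at t0 t1
  rw [s0] at c0
  rw [s1] at c1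
  change ∑ n ∈ Nc N K, _ + _ = _ at c0 c1
  change ∑ n ∈ Na K, _ - ∑ n ∈ Na K, _ = _ at t0 t1
  simp only [← Finset.sum_div, Finset.sum_add_distrib, ← Finset.mul_sum, s0, s1]
  linear_combination (ε * (deriv φ1 A / 2 + deriv φ2 (2 * A))) * (c0 + c1)
    + ε / 2 * deriv φ2 (2 * A) * (t1 - t0)
end
end

section
/- (Bond density lemma.) Let T ⊂ ℝ² be a nondegenerate triangle whose vertices belong to εℤ², and let r ∈ ℤ². Then ε² Σ_{x ∈ εℤ²} ⨍_x^{x+εr} χ_T db = |T|, where |T| is the area of T and the sum has only finitely many nonzero terms. -/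
open scoped BigOperators
open MeasureTheory Filter

noncomputable section

/-- Real vector with coordinates `f`. -/
def toV2 (f : Fin 2 → ℝ) : EuclideanSpace ℝ (Fin 2) :=
  (WithLp.equiv 2 (Fin 2 → ℝ)).symm f

/-- The point `εz ∈ ℝ²` of the scaled lattice `εℤ²`. -/
def latpt (ε : ℝ) (z : Fin 2 → ℤ) : EuclideanSpace ℝ (Fin 2) :=
  toV2 fun i => ε * (z i : ℝ)

/-- The integer vector `r` as a real vector. -/
def zvec (r : Fin 2 → ℤ) : EuclideanSpace ℝ (Fin 2) :=
  toV2 fun i => (r i : ℝ)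

/-- `χ` satisfies the defining density limit of `χ_T`:
`χ(x) = lim_{t↓0} |T ∩ B_t(x)|/|B_t(x)|`. -/
def IsDensityFn (T : Set (EuclideanSpace ℝ (Fin 2))) (χ : EuclideanSpace ℝ (Fin 2) → ℝ) : Prop :=
  ∀ x : EuclideanSpace ℝ (Fin 2),
    Tendsto (fun t : ℝ =>
        (volume (T ∩ Metric.closedBall x t)).toReal / (volume (Metric.closedBall x t)).toReal)
      (nhdsWithin 0 (Set.Ioi 0)) (nhds (χ x))

lemma latpt_apply (ε : ℝ) (z : Fin 2 → ℤ) (i : Fin 2) : latpt ε z i = ε * z i := rfl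

lemma latpt_add (ε : ℝ) (z w : Fin 2 → ℤ) : latpt ε (z + w) = latpt ε z + latpt ε w := by
  ext i
  simp only [latpt_apply, PiLp.add_apply, Pi.add_apply]
  push_cast
  ring

lemma latpt_sub (ε : ℝ) (z w : Fin 2 → ℤ) : latpt ε (z - w) = latpt ε z - latpt ε w := by
  ext i
  simp only [latpt_apply, PiLp.sub_apply, Pi.sub_apply]
  push_cast
  ring

lemma latpt_zsmul (ε : ℝ) (n : ℤ) (z : Fin 2 → ℤ) : latpt ε (n • z) = (n : ℝ) • latpt ε z := by
  ext i
  simp only [latpt_apply, PiLp.smul_apply, Pi.smul_apply, smul_eq_mul]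
  push_cast
  ring

lemma smul_zvec (ε : ℝ) (r : Fin 2 → ℤ) : ε • zvec r = latpt ε r := by
  ext i
  rfl

/-- If a set contains exactly one representative of each coset of a subgroup `H`, then the number
of its points in a coset of the full group is the index of `H`. -/
lemma tsum_indicator_eq_of_existsUnique {G E : Type*} [AddCommGroup G] [AddCommGroup E]
    (H : AddSubgroup G) (f : G →+ E) (S : Set E) (hS : ∀ y, ∃! h : H, y + f h ∈ S) (y : E) :
    ∑' g : G, S.indicator (1 : E → ENNReal) (y + f g) = ∑' _ : G ⧸ H, 1 := by
  have inner (q : E) : ∑' h : H, S.indicator (1 : E → ENNReal) (q + f h) = 1 := by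
    obtain ⟨h, hh, huniq⟩ := hS q
    rw [tsum_eq_single h]
    · simp [hh]
    · intro h' hne
      exact Set.indicator_of_notMem (fun hmem => hne (huniq h' hmem)) _
  let e : (G ⧸ H) × H ≃ G :=
    { toFun := fun p => p.1.out + p.2
      invFun := fun g => (g, ⟨-(g : G ⧸ H).out + g,
        QuotientAddGroup.eq.1 (QuotientAddGroup.out_eq' (g : G ⧸ H))⟩)
      left_inv := by
        rintro ⟨q, h⟩
        have hq : ((q.out + (h : G) : G) : G ⧸ H) = q := by
          rw [QuotientAddGroup.mk_add_of_mem _ h.2]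
          exact QuotientAddGroup.out_eq' q
        ext
        · exact hq
        · simp [hq]
      right_inv := by
        intro g
        simp }
  rw [← e.tsum_eq]
  refine (ENNReal.tsum_prod (f := fun (q : G ⧸ H) (h : H) =>
    S.indicator (1 : E → ENNReal) (y + f (q.out + (h : G))))).trans ?_
  refine tsum_congr fun q => ?_
  rw [← inner (y + f q.out)]
  simp [add_assoc]

lemma tsum_volume_inter_translate {ε : ℝ} {S : Set (EuclideanSpace ℝ (Fin 2))}
    (hS : MeasurableSet S) {D : ENNReal}
    (hD : ∀ y, ∑' z, S.indicator (1 : EuclideanSpace ℝ (Fin 2) → ENNReal) (y + latpt ε z) = D)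
    {Q : Set (EuclideanSpace ℝ (Fin 2))} (hQ : MeasurableSet Q) :
    ∑' z, volume (S ∩ {w | w - latpt ε z ∈ Q}) = D * volume Q := by
  have hz (z : Fin 2 → ℤ) : volume (S ∩ {w | w - latpt ε z ∈ Q}) =
      ∫⁻ w in Q, S.indicator 1 (w + latpt ε z) := by
    have hm : MeasurableSet {w | w - latpt ε z ∈ Q} := (measurable_sub_const _) hQ
    rw [← lintegral_indicator_one (hS.inter hm), ← lintegral_indicator hQ,
      ← lintegral_add_right_eq_self _ (latpt ε z)]
    congr 1
    ext w
    by_cases h1 : w ∈ Q <;> by_cases h2 : w + latpt ε z ∈ S <;> simp [h1, h2]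
  simp_rw [hz]
  rw [← lintegral_tsum]
  · simp [hD]
  · intro z
    exact ((measurable_one.indicator hS).comp (measurable_add_const _)).aemeasurable

lemma volume_eq_mul_of_tsum_indicator {ε : ℝ} (hε : 0 < ε) {S : Set (EuclideanSpace ℝ (Fin 2))}
    (hS : MeasurableSet S) {D : ENNReal}
    (hD : ∀ y, ∑' z, S.indicator (1 : EuclideanSpace ℝ (Fin 2) → ENNReal) (y + latpt ε z) = D) :
    volume S = D * ENNReal.ofReal (ε ^ 2) := by
  let Q : Set (EuclideanSpace ℝ (Fin 2)) := {y | y.ofLp ∈ Set.univ.pi fun _ => Set.Ico 0 ε}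
  have hQ' : MeasurableSet (Set.univ.pi fun _ : Fin 2 => Set.Ico (0 : ℝ) ε) :=
    MeasurableSet.univ_pi fun _ => measurableSet_Ico
  have hQ : MeasurableSet Q := (PiLp.volume_preserving_ofLp (Fin 2)).measurable hQ'
  have hvol : volume Q = ENNReal.ofReal (ε ^ 2) := by
    rw [show volume Q = _ from
      (PiLp.volume_preserving_ofLp (Fin 2)).measure_preimage hQ'.nullMeasurableSet,
      Real.volume_pi_Ico]
    simp [ENNReal.ofReal_pow hε.le]
  have key (w : EuclideanSpace ℝ (Fin 2)) (z : Fin 2 → ℤ) :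
      w - latpt ε z ∈ Q ↔ ∀ i, w i + (-z i) • ε ∈ Set.Ico 0 (0 + ε) := by
    simp [Q, latpt_apply, mul_comm, sub_eq_add_neg]
  rw [← hvol, ← tsum_volume_inter_translate hS hD hQ, ← measure_iUnion]
  · congr 1
    ext w
    simp only [Set.mem_iUnion, Set.mem_inter_iff, exists_and_left, Set.mem_ofPred_eq, key]
    refine ⟨fun h => ⟨h, ?_⟩, fun h => h.1⟩
    choose m hm _ using fun i => existsUnique_add_zsmul_mem_Ico hε (w i) 0
    exact ⟨-m, fun i => by simpa using hm i⟩
  · intro z z' hne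
    refine Set.disjoint_left.2 fun w hw hw' => hne (funext fun i => ?_)
    simpa using (existsUnique_add_zsmul_mem_Ico hε (w i) 0).unique
      ((key w z).1 hw.2 i) ((key w z').1 hw'.2 i)
  · intro z
    exact hS.inter ((measurable_sub_const _) hQ)

lemma finite_setOf_add_latpt_mem {ε : ℝ} (hε : 0 < ε) {U : Set (EuclideanSpace ℝ (Fin 2))}
    (hU : Bornology.IsBounded U) (y : EuclideanSpace ℝ (Fin 2)) :
    {z : Fin 2 → ℤ | y + latpt ε z ∈ U}.Finite := by
  obtain ⟨R, hR⟩ := hU.subset_closedBall (0 : EuclideanSpace ℝ (Fin 2))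
  set N : ℤ := ⌈(R + ‖y‖) / ε⌉
  refine (Set.finite_Icc (fun _ => -N) (fun _ => N)).subset fun z hz => ?_
  have hz' : ‖y + latpt ε z‖ ≤ R := by simpa using hR hz
  have hi (i : Fin 2) : |z i| ≤ N := by
    have h1 : ‖latpt ε z i‖ ≤ R + ‖y‖ := by
      refine (PiLp.norm_apply_le (latpt ε z) i).trans ?_
      have := norm_sub_le (y + latpt ε z) y
      rw [add_sub_cancel_left] at this
      linarith
    rw [latpt_apply, Real.norm_eq_abs, abs_mul, abs_of_pos hε, mul_comm, ← le_div_iff₀ hε] at h1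
    exact_mod_cast h1.trans (Int.le_ceil _)
  exact ⟨fun i => (abs_le.1 (hi i)).1, fun i => (abs_le.1 (hi i)).2⟩

lemma IsDensityFn.tendsto_ennreal {T : Set (EuclideanSpace ℝ (Fin 2))}
    {χ : EuclideanSpace ℝ (Fin 2) → ℝ} (hχ : IsDensityFn T χ) (x : EuclideanSpace ℝ (Fin 2)) :
    Tendsto (fun t : ℝ => volume (T ∩ Metric.closedBall x t) /
        volume (Metric.closedBall (0 : EuclideanSpace ℝ (Fin 2)) t))
      (nhdsWithin 0 (Set.Ioi 0)) (nhds (ENNReal.ofReal (χ x))) := by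
  refine (ENNReal.tendsto_ofReal (hχ x)).congr' ?_
  filter_upwards [self_mem_nhdsWithin] with t ht
  have hfin : volume (Metric.closedBall x t) ≠ ⊤ := measure_closedBall_lt_top.ne
  rw [← ENNReal.toReal_div, ENNReal.ofReal_toReal, Measure.addHaar_closedBall_center]
  exact ENNReal.div_ne_top (measure_ne_top_of_subset Set.inter_subset_right hfin)
    (Metric.measure_closedBall_pos volume x ht).ne'

lemma IsDensityFn.measurable {T : Set (EuclideanSpace ℝ (Fin 2))} (hT : MeasurableSet T)
    {χ : EuclideanSpace ℝ (Fin 2) → ℝ} (hχ : IsDensityFn T χ) : Measurable χ := by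
  have hlim : Tendsto (fun n : ℕ => 1 / ((n : ℝ) + 1)) atTop (nhdsWithin 0 (Set.Ioi 0)) :=
    tendsto_nhdsWithin_iff.2 ⟨tendsto_one_div_add_atTop_nhds_zero_nat,
      Eventually.of_forall fun n => Set.mem_Ioi.2 Nat.one_div_pos_of_nat⟩
  refine measurable_of_tendsto_metrizable (fun n => ?_)
    (tendsto_pi_nhds.2 fun x => (hχ x).comp hlim)
  simp only [Function.comp_apply, Measure.addHaar_closedBall_center]
  refine Measurable.div_const (Measurable.ennreal_toReal ?_) _
  exact measurable_measure_prodMk_left (s := {p : EuclideanSpace ℝ (Fin 2) × _ |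
    p.2 ∈ T ∧ dist p.2 p.1 ≤ 1 / ((n : ℝ) + 1)})
    ((measurable_snd hT).inter (measurableSet_le (measurable_snd.dist measurable_fst)
      measurable_const))

lemma IsDensityFn.nonneg {T : Set (EuclideanSpace ℝ (Fin 2))}
    {χ : EuclideanSpace ℝ (Fin 2) → ℝ} (hχ : IsDensityFn T χ) (x : EuclideanSpace ℝ (Fin 2)) :
    0 ≤ χ x :=
  ge_of_tendsto' (hχ x) fun _ => by positivity

/-- If `T` and its reflection `s - T` tile, up to null sets, a set `S` whose number of lattice
translates over each point is the constant `D`, then the densities of `T` and `s - T` sum to `D`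
over every translate of the lattice. -/
lemma IsDensityFn.tsum_add_reflection {ε : ℝ} (hε : 0 < ε)
    {S T : Set (EuclideanSpace ℝ (Fin 2))} (hS : MeasurableSet S) {D : ENNReal}
    (hD : ∀ y, ∑' z, S.indicator (1 : EuclideanSpace ℝ (Fin 2) → ENNReal) (y + latpt ε z) = D)
    (hT : MeasurableSet T) (hb : Bornology.IsBounded S) (s : EuclideanSpace ℝ (Fin 2))
    (htile : ∀ M, MeasurableSet M →
      volume (S ∩ M) = volume (T ∩ M) + volume ({w | s - w ∈ T} ∩ M))
    {χ : EuclideanSpace ℝ (Fin 2) → ℝ} (hχ : IsDensityFn T χ) (y : EuclideanSpace ℝ (Fin 2)) :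
    ∑' z, (ENNReal.ofReal (χ (y + latpt ε z)) + ENNReal.ofReal (χ (s - (y + latpt ε z)))) = D := by
  let q (t : ℝ) (z : Fin 2 → ℤ) : ENNReal :=
    volume (S ∩ Metric.closedBall (y + latpt ε z) t) /
      volume (Metric.closedBall (0 : EuclideanSpace ℝ (Fin 2)) t)
  have hq (z : Fin 2 → ℤ) : Tendsto (fun t => q t z) (nhdsWithin 0 (Set.Ioi 0))
      (nhds (ENNReal.ofReal (χ (y + latpt ε z)) +
        ENNReal.ofReal (χ (s - (y + latpt ε z))))) := by
    refine ((hχ.tendsto_ennreal _).add (hχ.tendsto_ennreal _)).congr fun t => ?_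
    have hrefl : volume (T ∩ Metric.closedBall (s - (y + latpt ε z)) t) =
        volume ({w | s - w ∈ T} ∩ Metric.closedBall (y + latpt ε z) t) := by
      rw [← (Measure.measurePreserving_sub_left volume s).measure_preimage
        (hT.inter measurableSet_closedBall).nullMeasurableSet]
      congr 1
      ext w
      simp only [Set.mem_preimage, Set.mem_inter_iff, Metric.mem_closedBall, Set.mem_ofPred_eq,
        dist_sub_left]
    simp only [q]
    rw [htile _ measurableSet_closedBall, hrefl, ENNReal.add_div]
  have hsum (t : ℝ) (ht : 0 < t) : ∑' z, q t z = D := by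
    have h1 := tsum_volume_inter_translate hS hD (measurableSet_closedBall (x := y) (ε := t))
    simp only [q, div_eq_mul_inv]
    rw [ENNReal.tsum_mul_right, ← Measure.addHaar_closedBall_center volume y t,
      ← div_eq_mul_inv]
    have h2 : (D * volume (Metric.closedBall y t)) / volume (Metric.closedBall y t) = D :=
      ENNReal.mul_div_cancel_right (Metric.measure_closedBall_pos volume y ht).ne'
        measure_closedBall_lt_top.ne
    rw [← h1] at h2
    rw [← h2]
    congr with z
    congr 2
    ext w
    simp [dist_eq_norm, sub_sub, add_comm]
  let K := (finite_setOf_add_latpt_mem hε (hb.cthickening (δ := 1)) y).toFinset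
  have hK (t : ℝ) (ht : t ≤ 1) (z) (hz : z ∉ K) : q t z = 0 := by
    have : S ∩ Metric.closedBall (y + latpt ε z) t = ∅ := by
      refine Set.eq_empty_of_forall_notMem fun w hw => hz ?_
      simp only [K, Set.Finite.mem_toFinset]
      exact Metric.mem_cthickening_of_dist_le _ w 1 S hw.1
        ((dist_comm _ _).trans_le ((Metric.mem_closedBall.1 hw.2).trans ht))
    simp [q, this]
  have hev : ∀ᶠ t : ℝ in nhdsWithin 0 (Set.Ioi 0), t ∈ Set.Ioc 0 1 :=
    Ioc_mem_nhdsGT one_pos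
  rw [tsum_eq_sum (s := K) fun z hz => tendsto_nhds_unique (hq z)
    (tendsto_const_nhds.congr' (hev.mono fun t ht => (hK t ht.2 z hz).symm))]
  refine tendsto_nhds_unique (tendsto_finsetSum K fun z _ => hq z)
    (tendsto_const_nhds.congr' (hev.mono fun t ht => ?_))
  rw [← hsum t ht.1, tsum_eq_sum (hK t ht.2)]

lemma volume_affineMap_level_eq_zero (f : EuclideanSpace ℝ (Fin 2) →ᵃ[ℝ] ℝ) (k : ℝ)
    {p : EuclideanSpace ℝ (Fin 2)} (hp : f p ≠ k) : volume {w | f w = k} = 0 := by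
  have h := Measure.addHaar_affineSubspace volume ((affineSpan ℝ {k}).comap f) fun htop => hp <| by
    have : p ∈ (affineSpan ℝ {k}).comap f := htop ▸ AffineSubspace.mem_top ℝ _ p
    simpa using this
  rw [← h]
  congr 1
  ext w
  simp

lemma affineMap_add_sub {E : Type*} [AddCommGroup E] [Module ℝ E] (f : E →ᵃ[ℝ] ℝ) (x y z : E) :
    f (x + y - z) = f x + f y - f z := by
  have h := f.map_vadd y (x - z)
  have h' := f.linearMap_vsub x z
  simp only [vadd_eq_add, vsub_eq_sub] at h h'
  rw [show x + y - z = x - z + y by abel, h, h']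
  ring

/-- The barycentric coordinates of a triangle with respect to its last two vertices. -/
lemma exists_triangle_coords {A B C : EuclideanSpace ℝ (Fin 2)}
    (h : AffineIndependent ℝ ![A, B, C]) :
    ∃ f g : EuclideanSpace ℝ (Fin 2) →ᵃ[ℝ] ℝ,
      f A = 0 ∧ f B = 1 ∧ f C = 0 ∧ g A = 0 ∧ g B = 0 ∧ g C = 1 ∧
      convexHull ℝ {A, B, C} = {w | 0 ≤ f w ∧ 0 ≤ g w ∧ f w + g w ≤ 1} ∧
      Bornology.IsBounded {w | f w ∈ Set.Ico 0 1 ∧ g w ∈ Set.Ico 0 1} := by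
  let p : AffineBasis (Fin 3) ℝ (EuclideanSpace ℝ (Fin 2)) :=
    ⟨![A, B, C], h, h.affineSpan_eq_top_iff_card_eq_finrank_add_one.2 (by simp)⟩
  have hc (i j) : p.coord i (p j) = if i = j then 1 else 0 := p.coord_apply i j
  have hA : p 0 = A := rfl
  have hB : p 1 = B := rfl
  have hC : p 2 = C := rfl
  have h1 (w) := p.sum_coord_apply_eq_one w
  have h2 (w) := p.linear_combination_coord_eq_self w
  simp only [Fin.sum_univ_three] at h1 h2
  refine ⟨p.coord 1, p.coord 2, ?_, ?_, ?_, ?_, ?_, ?_, ?_, ?_⟩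
  · simpa [hA] using hc 1 0
  · simpa [hB] using hc 1 1
  · simpa [hC] using hc 1 2
  · simpa [hA] using hc 2 0
  · simpa [hB] using hc 2 1
  · simpa [hC] using hc 2 2
  · have hr : Set.range p = {A, B, C} := by
      show Set.range ![A, B, C] = _
      simp only [Matrix.range_cons, Matrix.range_empty, Set.union_empty, Set.singleton_union]
    rw [← hr, p.convexHull_eq_nonneg_coord]
    ext w
    simp only [Set.mem_ofPred_eq, Fin.forall_fin_succ, Fin.isValue, Fin.succ_zero_eq_one,
      Fin.succ_one_eq_two, IsEmpty.forall_iff, and_true]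
    have := h1 w
    constructor
    · rintro ⟨x, y, z⟩
      exact ⟨y, z, by linarith⟩
    · rintro ⟨x, y, z⟩
      exact ⟨by linarith, x, y⟩
  · refine (Metric.isBounded_closedBall (x := 0) (r := ‖A‖ + ‖B‖ + ‖C‖)).subset fun w hw => ?_
    rw [mem_closedBall_zero_iff, ← h2 w, hA, hB, hC]
    have e0 : |p.coord 0 w| ≤ 1 := by
      have := h1 w
      rw [abs_le]
      constructor <;> linarith [hw.1.1, hw.1.2, hw.2.1, hw.2.2]
    have e1 : |p.coord 1 w| ≤ 1 := by rw [abs_of_nonneg hw.1.1]; exact hw.1.2.le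
    have e2 : |p.coord 2 w| ≤ 1 := by rw [abs_of_nonneg hw.2.1]; exact hw.2.2.le
    refine (norm_add₃_le).trans ?_
    simp only [norm_smul, Real.norm_eq_abs]
    gcongr
    · exact mul_le_of_le_one_left (norm_nonneg _) e0
    · exact mul_le_of_le_one_left (norm_nonneg _) e1
    · exact mul_le_of_le_one_left (norm_nonneg _) e2

/-- A half-open lattice parallelogram contains equally many points of every translate of the
lattice. -/
lemma exists_tsum_indicator_parallelogram (ε : ℝ) (a b c : Fin 2 → ℤ)
    (f g : EuclideanSpace ℝ (Fin 2) →ᵃ[ℝ] ℝ)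
    (hfa : f (latpt ε a) = 0) (hfb : f (latpt ε b) = 1) (hfc : f (latpt ε c) = 0)
    (hga : g (latpt ε a) = 0) (hgb : g (latpt ε b) = 0) (hgc : g (latpt ε c) = 1) :
    ∃ D : ENNReal, ∀ y, ∑' z, {w | f w ∈ Set.Ico 0 1 ∧ g w ∈ Set.Ico 0 1}.indicator
      (1 : EuclideanSpace ℝ (Fin 2) → ENNReal) (y + latpt ε z) = D := by
  let L : (Fin 2 → ℤ) →+ EuclideanSpace ℝ (Fin 2) :=
    AddMonoidHom.mk' (latpt ε) (latpt_add ε)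
  let ψ : ℤ × ℤ →+ (Fin 2 → ℤ) := AddMonoidHom.mk' (fun n => n.1 • (b - a) + n.2 • (c - a)) (by
    intro m n
    simp only [Prod.fst_add, Prod.snd_add, add_smul]
    abel)
  refine ⟨_, tsum_indicator_eq_of_existsUnique ψ.range L _ fun y => ?_⟩
  have hlat (k : EuclideanSpace ℝ (Fin 2) →ᵃ[ℝ] ℝ) (n : ℤ × ℤ) :
      k (y + L (ψ n)) = k y + (n.1 * (k (latpt ε b) - k (latpt ε a)) +
        n.2 * (k (latpt ε c) - k (latpt ε a))) := by
    have e : y + L (ψ n) =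
        ((n.1 : ℝ) • (latpt ε b - latpt ε a) + (n.2 : ℝ) • (latpt ε c - latpt ε a)) +ᵥ y := by
      simp [L, ψ, latpt_add, latpt_sub, latpt_zsmul, add_comm, -zsmul_eq_mul]
    rw [e, k.map_vadd, map_add, map_smul, map_smul, ← vsub_eq_sub, k.linearMap_vsub,
      ← vsub_eq_sub, k.linearMap_vsub]
    simp [add_comm]
  have hmem (n : ℤ × ℤ) : y + L (ψ n) ∈ {w | f w ∈ Set.Ico 0 1 ∧ g w ∈ Set.Ico 0 1} ↔
      f y + n.1 • (1 : ℝ) ∈ Set.Ico (0 : ℝ) (0 + 1) ∧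
      g y + n.2 • (1 : ℝ) ∈ Set.Ico (0 : ℝ) (0 + 1) := by
    simp only [Set.mem_ofPred_eq, hlat, hfa, hfb, hfc, hga, hgb, hgc]
    simp
  obtain ⟨m, hm, hm'⟩ := existsUnique_add_zsmul_mem_Ico one_pos (f y) 0
  obtain ⟨n, hn, hn'⟩ := existsUnique_add_zsmul_mem_Ico one_pos (g y) 0
  refine ⟨⟨ψ (m, n), ⟨_, rfl⟩⟩, (hmem (m, n)).2 ⟨hm, hn⟩, ?_⟩
  rintro ⟨_, ⟨⟨m', n'⟩, rfl⟩⟩ h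
  have h' := (hmem (m', n')).1 h
  simp only [hm' m' h'.1, hn' n' h'.2]

/-- A triangle and its reflection through the midpoint of an edge tile a parallelogram. -/
lemma volume_parallelogram_inter (f g : EuclideanSpace ℝ (Fin 2) →ᵃ[ℝ] ℝ)
    {A s : EuclideanSpace ℝ (Fin 2)} (hfA : f A = 0) (hgA : g A = 0)
    (hfs : ∀ w, f (s - w) = 1 - f w) (hgs : ∀ w, g (s - w) = 1 - g w)
    {T : Set (EuclideanSpace ℝ (Fin 2))}
    (hT : T = {w | 0 ≤ f w ∧ 0 ≤ g w ∧ f w + g w ≤ 1}) (hTm : MeasurableSet T)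
    {M : Set (EuclideanSpace ℝ (Fin 2))} (hM : MeasurableSet M) :
    volume ({w | f w ∈ Set.Ico 0 1 ∧ g w ∈ Set.Ico 0 1} ∩ M) =
      volume (T ∩ M) + volume ({w | s - w ∈ T} ∩ M) := by
  have hf := volume_affineMap_level_eq_zero f 1 (p := A) (by simp [hfA])
  have hg := volume_affineMap_level_eq_zero g 1 (p := A) (by simp [hgA])
  have hfg := volume_affineMap_level_eq_zero (f + g) 1 (p := A) (by simp [hfA, hgA])
  have hT' : MeasurableSet {w | s - w ∈ T} := (measurable_const_sub s) hTm
  rw [← measure_union₀ (hT'.inter hM).nullMeasurableSet]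
  · refine measure_congr ?_
    filter_upwards [measure_eq_zero_iff_ae_notMem.1 hf, measure_eq_zero_iff_ae_notMem.1 hg]
      with w h1 h2
    refine propext ?_
    change w ∈ {w | f w ∈ Set.Ico 0 1 ∧ g w ∈ Set.Ico 0 1} ∩ M ↔
      w ∈ T ∩ M ∪ {w | s - w ∈ T} ∩ M
    change f w ≠ 1 at h1
    change g w ≠ 1 at h2
    simp only [hT, Set.mem_inter_iff, Set.mem_union, Set.mem_ofPred_eq, Set.mem_Ico, hfs, hgs,
      ← or_and_right]
    refine and_congr_left fun _ => ⟨fun h => ?_, ?_⟩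
    · rcases le_total (f w + g w) 1 with h' | h'
      · exact Or.inl ⟨h.1.1, h.2.1, h'⟩
      · exact Or.inr ⟨by linarith [h.1.2], by linarith [h.2.2], by linarith⟩
    · rintro (h | h)
      · exact ⟨⟨h.1, lt_of_le_of_ne (by linarith [h.2.1]) h1⟩,
          h.2.1, lt_of_le_of_ne (by linarith [h.1]) h2⟩
      · exact ⟨⟨by linarith [h.2.1, h.2.2], lt_of_le_of_ne (by linarith [h.1]) h1⟩,
          by linarith [h.1, h.2.2], lt_of_le_of_ne (by linarith [h.2.1]) h2⟩
  · refine measure_mono_null (fun w hw => ?_) hfg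
    subst hT
    have h1 := hw.1.1
    have h2 := hw.2.1
    simp only [Set.mem_ofPred_eq, hfs, hgs] at h1 h2
    show f w + g w = 1
    linarith [h1.2.2, h2.2.2]

/-- Bond density lemma: for a nondegenerate triangle `T` with vertices on
`εℤ²` and any `r ∈ ℤ²`, `ε² ∑_{x∈εℤ²} ⨍_x^{x+εr} χ_T db = |T|`; the sum (which has
finitely many nonzero terms) is expressed as a `HasSum`. -/
theorem stmt_8 (ε : ℝ) (hε : 0 < ε) (a b c : Fin 2 → ℤ)
    (hnd : AffineIndependent ℝ ![latpt ε a, latpt ε b, latpt ε c])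
    (r : Fin 2 → ℤ)
    (χ : EuclideanSpace ℝ (Fin 2) → ℝ)
    (hχ : IsDensityFn
      (convexHull ℝ {latpt ε a, latpt ε b, latpt ε c} : Set (EuclideanSpace ℝ (Fin 2))) χ) :
    HasSum (fun x : Fin 2 → ℤ => ε ^ 2 * ∫ t in (0:ℝ)..1, χ (latpt ε x + t • (ε • zvec r)))
      (volume (convexHull ℝ {latpt ε a, latpt ε b, latpt ε c}
        : Set (EuclideanSpace ℝ (Fin 2)))).toReal := by
  set T := convexHull ℝ {latpt ε a, latpt ε b, latpt ε c} with hTdef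
  obtain ⟨f, g, hfa, hfb, hfc, hga, hgb, hgc, hT, hb⟩ := exists_triangle_coords hnd
  rw [← hTdef] at hT
  set S : Set (EuclideanSpace ℝ (Fin 2)) := {w | f w ∈ Set.Ico 0 1 ∧ g w ∈ Set.Ico 0 1}
  have hfm : Measurable f := f.continuous_of_finiteDimensional.measurable
  have hgm : Measurable g := g.continuous_of_finiteDimensional.measurable
  have hSm : MeasurableSet S := (hfm measurableSet_Ico).inter (hgm measurableSet_Ico)
  have hTm : MeasurableSet T := by
    rw [hT]
    exact (measurableSet_le measurable_const hfm).inter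
      ((measurableSet_le measurable_const hgm).inter
        (measurableSet_le (hfm.add hgm) measurable_const))
  obtain ⟨D, hD⟩ := exists_tsum_indicator_parallelogram ε a b c f g hfa hfb hfc hga hgb hgc
  have hs : latpt ε (b + c) = latpt ε b + latpt ε c := latpt_add ε b c
  have htile (M : Set (EuclideanSpace ℝ (Fin 2))) (hM : MeasurableSet M) :=
    volume_parallelogram_inter f g (s := latpt ε (b + c)) hfa hga
      (fun w => by rw [hs, affineMap_add_sub, hfb, hfc, add_zero])
      (fun w => by rw [hs, affineMap_add_sub, hgb, hgc, zero_add]) hT hTm hM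
  have hpt := hχ.tsum_add_reflection hε hSm hD hTm hb (latpt ε (b + c)) htile
  have hχm := hχ.measurable hTm
  let I (x : Fin 2 → ℤ) : ENNReal :=
    ∫⁻ t in Set.Icc (0 : ℝ) 1, ENNReal.ofReal (χ (latpt ε x + t • latpt ε r))
  have hI (x : Fin 2 → ℤ) :
      ∫ t in (0:ℝ)..1, χ (latpt ε x + t • (ε • zvec r)) = (I x).toReal := by
    rw [smul_zvec, intervalIntegral.integral_of_le zero_le_one, ← integral_Icc_eq_integral_Ioc,
      integral_eq_lintegral_of_nonneg_ae (Eventually.of_forall fun t => hχ.nonneg _)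
        (Measurable.aestronglyMeasurable (by fun_prop))]
  have hflip (x : Fin 2 → ℤ) : I (b + c - r - x) = ∫⁻ t in Set.Icc (0 : ℝ) 1,
      ENNReal.ofReal (χ (latpt ε (b + c) - (t • latpt ε r + latpt ε x))) := by
    simp only [I]
    rw [← lintegral_indicator measurableSet_Icc, ← lintegral_indicator measurableSet_Icc,
      ← lintegral_sub_left_eq_self _ 1]
    congr 1
    ext t
    have ht : 1 - t ∈ Set.Icc (0 : ℝ) 1 ↔ t ∈ Set.Icc (0 : ℝ) 1 := by
      simp [and_comm]
    by_cases h : t ∈ Set.Icc (0 : ℝ) 1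
    · rw [Set.indicator_of_mem (ht.2 h), Set.indicator_of_mem h, latpt_sub, latpt_sub]
      congr 2
      module
    · rw [Set.indicator_of_notMem (mt ht.1 h), Set.indicator_of_notMem h]
  have htwo : 2 * ∑' x, I x = D := by
    rw [two_mul]
    nth_rw 2 [← (Equiv.subLeft (b + c - r)).tsum_eq I]
    rw [← ENNReal.tsum_add]
    calc ∑' x, (I x + I (b + c - r - x))
        = ∑' x, ∫⁻ t in Set.Icc (0 : ℝ) 1, (ENNReal.ofReal (χ (t • latpt ε r + latpt ε x)) +
            ENNReal.ofReal (χ (latpt ε (b + c) - (t • latpt ε r + latpt ε x)))) := by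
          refine tsum_congr fun x => ?_
          rw [hflip, lintegral_add_left (by fun_prop)]
          simp only [I, add_comm]
      _ = D := by
          rw [← lintegral_tsum fun x => by fun_prop]
          simp [hpt]
  have hvol : volume S = D * ENNReal.ofReal (ε ^ 2) := volume_eq_mul_of_tsum_indicator hε hSm hD
  have hrefl : volume {w | latpt ε (b + c) - w ∈ T} = volume T :=
    (Measure.measurePreserving_sub_left volume _).measure_preimage hTm.nullMeasurableSet
  have hST : volume S = 2 * volume T := by
    have := htile Set.univ MeasurableSet.univ
    simp only [Set.inter_univ] at this
    rw [this, hrefl, two_mul]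
  have hTI : volume T = ENNReal.ofReal (ε ^ 2) * ∑' x, I x := by
    rw [← ENNReal.mul_right_inj two_ne_zero ENNReal.ofNat_ne_top, ← hST, hvol, ← htwo]
    ring
  have hε2 : ENNReal.ofReal (ε ^ 2) ≠ 0 := by
    simpa using hε.ne'
  have hfin : ∑' x, I x ≠ ⊤ := by
    intro htop
    rw [htop, ENNReal.mul_top hε2] at hTI
    have hle : volume T ≤ volume S := hST ▸ le_mul_of_one_le_left' one_le_two
    exact (hTI ▸ hle).not_gt hb.measure_lt_top
  simp only [hI]
  rw [hTI, ENNReal.toReal_mul, ENNReal.toReal_ofReal (by positivity)]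
  have hne (x : Fin 2 → ℤ) : I x ≠ ⊤ := ENNReal.ne_top_of_tsum_ne_top hfin x
  rw [ENNReal.tsum_toReal_eq hne]
  exact ((ENNReal.hasSum_toReal hfin).mul_left (ε ^ 2))
end
end

section
/- (Periodic bond density lemma.) Let N ≥ 1 be an integer, ε := 1/N, and 𝓛 := ε·{−N+1,…,N}². Let T ⊂ ℝ² be a nondegenerate triangle whose vertices belong to εℤ², let r ∈ ℤ², and define χ_{T^#}(x) := Σ_{ξ∈2ℤ²} χ_T(x − ξ). Then ε² Σ_{x ∈ 𝓛} ⨍_x^{x+εr} χ_{T^#} db = |T|, where |T| is the area of T. -/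
open scoped BigOperators
open MeasureTheory Filter

noncomputable section

/-- The periodic reference cell `𝓛 = ε·{−N+1,…,N}²` in integer coordinates. -/
def cell2 (N : ℕ) : Finset (Fin 2 → ℤ) :=
  Fintype.piFinset fun _ => Finset.Icc (-(N : ℤ) + 1) (N : ℤ)

/-- Summing over a group coset by coset of the image of an injective homomorphism. -/
lemma tsum_eq_tsum_quotient_range {A G : Type*} [AddCommGroup A] [AddCommGroup G]
    (φ : A →+ G) (hφ : Function.Injective φ) (h : G → ENNReal) :
    ∑' g, h g = ∑' q : G ⧸ φ.range, ∑' m, h (q.out + φ m) := by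
  have hb : Function.Bijective fun p : (G ⧸ φ.range) × A => p.1.out + φ p.2 := by
    constructor
    · rintro ⟨q, m⟩ ⟨q', m'⟩ hqm
      have hmk : ∀ (q : G ⧸ φ.range) (m : A),
          ((q.out + φ m : G) : G ⧸ φ.range) = q := fun q m => by
        rw [QuotientAddGroup.mk_add_of_mem _ (AddMonoidHom.mem_range.2 ⟨m, rfl⟩)]
        exact QuotientAddGroup.out_eq' q
      have hq : q = q' := by
        rw [← hmk q m, ← hmk q' m']
        exact congrArg _ hqm
      subst hq
      simpa using hφ (add_left_cancel hqm)
    · intro g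
      obtain ⟨m, hm⟩ : -(g : G ⧸ φ.range).out + g ∈ φ.range :=
        QuotientAddGroup.eq.1 (QuotientAddGroup.out_eq' _)
      exact ⟨(g, m), by simp [hm]⟩
  rw [← (Equiv.ofBijective _ hb).tsum_eq, ENNReal.tsum_prod']
  rfl

/-- Off the lines where a barycentric coordinate is an integer, the integer translates of the
standard triangle and of its point reflection cover each point exactly once. -/
lemma tsum_standard_triangle {s t l : ℝ} (hsum : l + s + t = 1) (hs : ∀ n : ℤ, s ≠ n)
    (ht : ∀ n : ℤ, t ≠ n) (hl : ∀ n : ℤ, l ≠ n) :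
    ∑' m : Fin 2 → ℤ,
      ({p : ℝ × ℝ | 0 ≤ p.1 ∧ 0 ≤ p.2 ∧ p.1 + p.2 ≤ 1}.indicator (1 : ℝ × ℝ → ENNReal)
          (s + m 0, t + m 1) +
        {p : ℝ × ℝ | p.1 ≤ 1 ∧ p.2 ≤ 1 ∧ 1 ≤ p.1 + p.2}.indicator (1 : ℝ × ℝ → ENNReal)
          (s + m 0, t + m 1)) = 1 := by
  have h1 := Int.fract_lt_one s
  have h2 := Int.fract_lt_one t
  have h1' := Int.fract_nonneg s
  have h2' := Int.fract_nonneg t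
  rw [tsum_eq_single ![-⌊s⌋, -⌊t⌋]]
  · have e1 : s + ((![-⌊s⌋, -⌊t⌋] : Fin 2 → ℤ) 0 : ℝ) = Int.fract s := by
      simp [Int.fract, sub_eq_add_neg]
    have e2 : t + ((![-⌊s⌋, -⌊t⌋] : Fin 2 → ℤ) 1 : ℝ) = Int.fract t := by
      simp [Int.fract, sub_eq_add_neg]
    rw [e1, e2]
    have hne : Int.fract s + Int.fract t ≠ 1 := by
      intro h
      apply hl (-⌊s⌋ - ⌊t⌋)
      push_cast
      simp only [Int.fract] at h
      linarith
    rcases lt_or_gt_of_ne hne with h | h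
    · rw [Set.indicator_of_mem (by simp [*, h.le]), Set.indicator_of_notMem (by simp [h])]
      simp
    · rw [Set.indicator_of_notMem (by simp [h]), Set.indicator_of_mem (by simp [h1.le, h2.le, h.le])]
      simp
  · intro m hm
    have key : ¬ (0 ≤ s + m 0 ∧ s + m 0 ≤ 1 ∧ 0 ≤ t + m 1 ∧ t + m 1 ≤ 1) := by
      rintro ⟨a1, a2, a3, a4⟩
      have b1 : s + m 0 ≠ 1 := fun h => hs (1 - m 0) (by push_cast; linarith)
      have b2 : t + m 1 ≠ 1 := fun h => ht (1 - m 1) (by push_cast; linarith)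
      apply hm
      have f1 : ⌊s⌋ = -m 0 := by
        rw [Int.floor_eq_iff]; push_cast
        exact ⟨by linarith, by linarith [lt_of_le_of_ne a2 b1]⟩
      have f2 : ⌊t⌋ = -m 1 := by
        rw [Int.floor_eq_iff]; push_cast
        exact ⟨by linarith, by linarith [lt_of_le_of_ne a4 b2]⟩
      ext i; fin_cases i <;> simp [f1, f2]
    rw [Set.indicator_of_notMem, Set.indicator_of_notMem, add_zero]
    · rintro ⟨a1, a2, a3⟩
      exact key ⟨by linarith, by linarith, by linarith, by linarith⟩
    · rintro ⟨a1, a2, a3⟩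
      exact key ⟨by linarith, by linarith, by linarith, by linarith⟩

/-- A nonconstant affine functional is almost everywhere non-integral. -/
lemma ae_affine_ne_int (f : EuclideanSpace ℝ (Fin 2) →ᵃ[ℝ] ℝ)
    {p q : EuclideanSpace ℝ (Fin 2)} (hpq : f p ≠ f q) :
    ∀ᵐ y : EuclideanSpace ℝ (Fin 2), ∀ n : ℤ, f y ≠ n := by
  rw [ae_all_iff]
  intro n
  have h := Measure.addHaar_affineSubspace (volume : Measure (EuclideanSpace ℝ (Fin 2)))
    ((AffineSubspace.mk' (n : ℝ) ⊥).comap f) ?_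
  · rw [ae_iff]
    convert h using 2
    ext y
    simp [sub_eq_zero]
  · intro htop
    have hm : ∀ y, f y = n := fun y => by
      have : y ∈ (AffineSubspace.mk' (n : ℝ) ⊥).comap f := htop ▸ AffineSubspace.mem_top ℝ _ y
      simpa [sub_eq_zero] using this
    exact hpq (by rw [hm, hm])

/-- The scaled lattice as an additive homomorphism. -/
def latHom (ε : ℝ) : (Fin 2 → ℤ) →+ EuclideanSpace ℝ (Fin 2) where
  toFun := latpt ε
  map_zero' := by ext i; simp [latpt, toV2]
  map_add' z w := by ext i; simp [latpt, toV2, mul_add]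

@[simp] lemma latHom_apply_coord (ε : ℝ) (z : Fin 2 → ℤ) (i : Fin 2) :
    latHom ε z i = ε * z i := rfl

/-- The number of points of `y + εℤ²` in `T`. -/
def latCount (ε : ℝ) (T : Set (EuclideanSpace ℝ (Fin 2))) (y : EuclideanSpace ℝ (Fin 2)) :
    ENNReal :=
  ∑' z, T.indicator 1 (y + latHom ε z)

lemma latCount_neg (ε : ℝ) (T : Set (EuclideanSpace ℝ (Fin 2))) (y : EuclideanSpace ℝ (Fin 2)) :
    latCount ε (-T) y = latCount ε T (-y) := by
  unfold latCount
  rw [← (Equiv.neg (Fin 2 → ℤ)).tsum_eq]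
  refine tsum_congr fun z => ?_
  have : -y + latHom ε z = -(y + latHom ε (-z)) := by simp [add_comm]
  rw [this]
  rfl

/-- The lattice point counts of a lattice triangle and of its reflection add up to a constant. -/
lemma exists_latCount_add_latCount_neg_eq (ε : ℝ) (a b c : Fin 2 → ℤ)
    (hnd : AffineIndependent ℝ ![latHom ε a, latHom ε b, latHom ε c]) :
    ∃ D : ENNReal, ∀ᵐ y : EuclideanSpace ℝ (Fin 2),
      latCount ε (convexHull ℝ {latHom ε a, latHom ε b, latHom ε c}) y +
        latCount ε (-convexHull ℝ {latHom ε a, latHom ε b, latHom ε c}) y = D := by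
  set T := convexHull ℝ {latHom ε a, latHom ε b, latHom ε c} with hT
  let B : AffineBasis (Fin 3) ℝ (EuclideanSpace ℝ (Fin 2)) :=
    ⟨![latHom ε a, latHom ε b, latHom ε c], hnd, by
      rw [hnd.affineSpan_eq_top_iff_card_eq_finrank_add_one]; simp⟩
  have hBa : B 0 = latHom ε a := rfl
  have hBb : B 1 = latHom ε b := rfl
  have hBc : B 2 = latHom ε c := rfl
  have hrange : Set.range B = {latHom ε a, latHom ε b, latHom ε c} := by
    change Set.range ![latHom ε a, latHom ε b, latHom ε c] = _
    rw [Matrix.range_cons, Matrix.range_cons, Matrix.range_cons, Matrix.range_empty,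
      Set.union_empty]
    rfl
  have hmem : ∀ x, x ∈ T ↔ 0 ≤ B.coord 1 x ∧ 0 ≤ B.coord 2 x ∧ B.coord 1 x + B.coord 2 x ≤ 1 := by
    intro x
    rw [hT, ← hrange, B.convexHull_eq_nonneg_coord]
    have hone := B.sum_coord_apply_eq_one x
    rw [Fin.sum_univ_three] at hone
    constructor
    · intro h
      have h0 : 0 ≤ B.coord 0 x := h 0
      exact ⟨h 1, h 2, by linarith⟩
    · rintro ⟨h1, h2, h3⟩ i
      fin_cases i
      · change 0 ≤ B.coord 0 x
        linarith
      · exact h1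
      · exact h2
  have hB : ∀ i j, B.coord i (B j) = if i = j then 1 else 0 := B.coord_apply
  let φ : (Fin 2 → ℤ) →+ (Fin 2 → ℤ) :=
    { toFun := fun m => m 0 • (b - a) + m 1 • (c - a)
      map_zero' := by simp
      map_add' := fun m m' => by simp only [Pi.add_apply, add_smul]; abel }
  have hlin : ∀ i (m : Fin 2 → ℤ), (B.coord i).linear (latHom ε (φ m)) =
      m 0 * (B.coord i (B 1) - B.coord i (B 0)) + m 1 * (B.coord i (B 2) - B.coord i (B 0)) := by
    intro i m
    change (B.coord i).linear (latHom ε (m 0 • (b - a) + m 1 • (c - a))) = _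
    rw [map_add, map_zsmul, map_zsmul, map_sub, map_sub, ← hBa, ← hBb, ← hBc, map_add, map_zsmul,
      map_zsmul, ← vsub_eq_sub, ← vsub_eq_sub, AffineMap.linearMap_vsub, AffineMap.linearMap_vsub]
    simp
  have hshift : ∀ i x (m : Fin 2 → ℤ), B.coord i (x + latHom ε (φ m)) =
      B.coord i x + (m 0 * (B.coord i (B 1) - B.coord i (B 0)) +
        m 1 * (B.coord i (B 2) - B.coord i (B 0))) := by
    intro i x m
    rw [add_comm x, ← vadd_eq_add, AffineMap.map_vadd, hlin, vadd_eq_add, add_comm]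
  have hrefl : ∀ i x, B.coord i (latHom ε (b + c) - x) =
      B.coord i (B 1) + B.coord i (B 2) - B.coord i x := by
    intro i x
    have h1 : latHom ε (b + c) - x = (B 2 - x) +ᵥ B 1 := by
      rw [map_add, hBb, hBc, vadd_eq_add]; abel
    rw [h1, AffineMap.map_vadd, ← vsub_eq_sub, AffineMap.linearMap_vsub, vadd_eq_add, vsub_eq_sub]
    ring
  have hφ : Function.Injective φ := by
    rw [injective_iff_map_eq_zero]
    intro m hm
    have h1 := hlin 1 m
    have h2 := hlin 2 m
    rw [hm] at h1 h2
    simp [hB] at h1 h2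
    ext i
    fin_cases i
    · exact_mod_cast h1.symm
    · exact_mod_cast h2.symm
  refine ⟨∑' _ : (Fin 2 → ℤ) ⧸ φ.range, 1, ?_⟩
  have hae : ∀ᵐ y : EuclideanSpace ℝ (Fin 2), ∀ (z : Fin 2 → ℤ) (i : Fin 3) (n : ℤ),
      B.coord i (y + latHom ε z) ≠ n := by
    rw [ae_all_iff]
    intro z
    rw [ae_all_iff]
    intro i
    refine (eventually_add_right_iff volume (latHom ε z)
      (p := fun y => ∀ n : ℤ, B.coord i y ≠ n)).2 ?_
    refine ae_affine_ne_int (B.coord i) (p := B i) (q := B (i + 1)) ?_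
    fin_cases i <;> simp [hB]
  filter_upwards [hae] with y hy
  have hneg : latCount ε (-T) y = ∑' z, T.indicator 1 (latHom ε (b + c) - (y + latHom ε z)) := by
    unfold latCount
    rw [← (Equiv.subRight (b + c)).tsum_eq]
    refine tsum_congr fun z => ?_
    have : latHom ε (b + c) - (y + latHom ε z) =
        -(y + latHom ε (Equiv.subRight (b + c) z)) := by
      simp only [Equiv.subRight_apply, map_sub]; abel
    rw [this]
    rfl
  rw [hneg, latCount, ← ENNReal.tsum_add, tsum_eq_tsum_quotient_range φ hφ]
  refine tsum_congr fun q => ?_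
  have hone := B.sum_coord_apply_eq_one (y + latHom ε q.out)
  rw [Fin.sum_univ_three] at hone
  rw [← tsum_standard_triangle hone (hy q.out 1) (hy q.out 2) (hy q.out 0)]
  refine tsum_congr fun m => ?_
  have e1 : B.coord 1 (y + latHom ε q.out) + m 0 = B.coord 1 (y + latHom ε (q.out + φ m)) := by
    rw [map_add (latHom ε), ← add_assoc, hshift]; simp [hB]
  have e2 : B.coord 2 (y + latHom ε q.out) + m 1 = B.coord 2 (y + latHom ε (q.out + φ m)) := by
    rw [map_add (latHom ε), ← add_assoc, hshift]; simp [hB]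
  rw [e1, e2]
  congr 1
  · refine Set.indicator_eq_indicator ?_ rfl
    rw [hmem]; rfl
  · refine Set.indicator_eq_indicator ?_ rfl
    rw [hmem, hrefl, hrefl]
    rw [hB, hB, hB, hB, if_pos rfl, if_neg (by decide), if_neg (by decide), if_pos rfl]
    simp only [Set.mem_ofPred_eq]
    constructor <;> rintro ⟨h1, h2, h3⟩ <;> refine ⟨?_, ?_, ?_⟩ <;> linarith

lemma measurable_latCount (ε : ℝ) {T : Set (EuclideanSpace ℝ (Fin 2))} (hT : MeasurableSet T) :
    Measurable (latCount ε T) :=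
  Measurable.tsum fun _ => (measurable_one.indicator hT).comp (measurable_add_const _)

lemma setLIntegral_latCount (ε : ℝ) {T : Set (EuclideanSpace ℝ (Fin 2))} (hT : MeasurableSet T)
    (S : Set (EuclideanSpace ℝ (Fin 2))) :
    ∫⁻ y in S, latCount ε T y = ∑' z, volume ((· + latHom ε z) ⁻¹' T ∩ S) := by
  unfold latCount
  rw [lintegral_tsum]
  · refine tsum_congr fun z => ?_
    have hm : MeasurableSet ((· + latHom ε z) ⁻¹' T) := measurable_add_const _ hT
    rw [← Measure.restrict_apply hm, ← lintegral_indicator_one hm]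
    rfl
  · intro z
    exact ((measurable_one.indicator hT).comp (measurable_add_const _)).aemeasurable

lemma setLIntegral_latCount_closedBall (ε : ℝ) {T : Set (EuclideanSpace ℝ (Fin 2))}
    (hT : MeasurableSet T) (x : EuclideanSpace ℝ (Fin 2)) (t : ℝ) :
    ∫⁻ y in Metric.closedBall x t, latCount ε T y =
      ∑' z, volume (T ∩ Metric.closedBall (x + latHom ε z) t) := by
  rw [setLIntegral_latCount ε hT]
  refine tsum_congr fun z => ?_
  rw [← measure_preimage_add_right volume (latHom ε z)
    (T ∩ Metric.closedBall (x + latHom ε z) t)]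
  congr 1
  ext y
  simp

/-- The half-open square `[0, ε)²`. -/
def square (ε : ℝ) : Set (EuclideanSpace ℝ (Fin 2)) := {y | ∀ i, y i ∈ Set.Ico 0 ε}

lemma measurableSet_square (ε : ℝ) : MeasurableSet (square ε) := by
  have : square ε = ⋂ i, (fun y : EuclideanSpace ℝ (Fin 2) => y i) ⁻¹' Set.Ico 0 ε := by
    ext; simp [square]
  rw [this]
  exact MeasurableSet.iInter fun i => measurableSet_Ico.preimage (by fun_prop)

lemma volume_square (ε : ℝ) : volume (square ε) = ENNReal.ofReal ε ^ 2 := by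
  have h := (PiLp.volume_preserving_ofLp (Fin 2)).measure_preimage
    (MeasurableSet.univ_pi fun _ : Fin 2 => measurableSet_Ico (a := (0 : ℝ)) (b := ε)).nullMeasurableSet
  rw [Real.volume_pi_Ico] at h
  have e : square ε = (WithLp.ofLp : EuclideanSpace ℝ (Fin 2) → Fin 2 → ℝ) ⁻¹'
      (Set.univ.pi fun _ : Fin 2 => Set.Ico (0 : ℝ) ε) := by
    ext; simp [square]
  rw [e, h]
  simp [sq]

/-- The lattice point count of `T` has integral `|T|` over a fundamental square. -/
lemma setLIntegral_latCount_square {ε : ℝ} (hε : 0 < ε) {T : Set (EuclideanSpace ℝ (Fin 2))}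
    (hT : MeasurableSet T) : ∫⁻ y in square ε, latCount ε T y = volume T := by
  rw [setLIntegral_latCount ε hT]
  have hset : ∀ z, volume ((· + latHom ε z) ⁻¹' T ∩ square ε) =
      volume (T ∩ (· - latHom ε z) ⁻¹' square ε) := by
    intro z
    rw [← measure_preimage_add_right volume (latHom ε z)
      (T ∩ (· - latHom ε z) ⁻¹' square ε)]
    congr 1
    ext y
    simp
  simp_rw [hset]
  have hfloor : ∀ (y : EuclideanSpace ℝ (Fin 2)) z, y - latHom ε z ∈ square ε ↔
      z = fun i => ⌊y i / ε⌋ := by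
    intro y z
    rw [eq_comm, funext_iff]
    refine forall_congr' fun i => ?_
    simp only [PiLp.sub_apply, latHom_apply_coord]
    rw [Int.floor_eq_iff, le_div_iff₀ hε, div_lt_iff₀ hε, Set.mem_Ico]
    constructor <;> rintro ⟨h1, h2⟩ <;> constructor <;> linarith
  rw [← measure_iUnion, ← Set.inter_iUnion]
  · congr 1
    refine Set.inter_eq_left.2 fun y _ => Set.mem_iUnion.2 ⟨_, (hfloor y _).2 rfl⟩
  · intro z w hzw
    refine Set.disjoint_left.2 fun y hy hy' => hzw ?_
    rw [(hfloor y z).1 hy.2, (hfloor y w).1 hy'.2]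
  · exact fun z => hT.inter ((measurable_sub_const _) (measurableSet_square ε))

lemma mul_eq_two_mul_volume {ε : ℝ} (hε : 0 < ε) {T : Set (EuclideanSpace ℝ (Fin 2))}
    (hT : MeasurableSet T) {D : ENNReal}
    (hD : ∀ᵐ y : EuclideanSpace ℝ (Fin 2), latCount ε T y + latCount ε (-T) y = D) :
    D.toReal * ε ^ 2 = 2 * (volume T).toReal := by
  have h : ∫⁻ y in square ε, (latCount ε T y + latCount ε (-T) y) = D * ENNReal.ofReal ε ^ 2 := by
    rw [lintegral_congr_ae (ae_restrict_of_ae hD), setLIntegral_const, volume_square]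
  rw [lintegral_add_left (measurable_latCount ε hT), setLIntegral_latCount_square hε hT,
    setLIntegral_latCount_square hε hT.neg, Measure.measure_neg, ← two_mul] at h
  simpa [hε.le] using (congrArg ENNReal.toReal h).symm

lemma finite_norm_latHom_le {ε : ℝ} (hε : 0 < ε) (R : ℝ) : {z | ‖latHom ε z‖ ≤ R}.Finite := by
  refine (Set.Finite.pi' (t := fun _ : Fin 2 => Set.Icc (-⌈R / ε⌉) ⌈R / ε⌉)
    fun _ => Set.finite_Icc _ _).subset fun z hz i => ?_
  have h1 : |ε * (z i : ℝ)| ≤ R := by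
    rw [← latHom_apply_coord, ← Real.norm_eq_abs]
    exact (PiLp.norm_apply_le _ i).trans hz
  rw [abs_mul, abs_of_pos hε, mul_comm, ← le_div_iff₀ hε] at h1
  have h2 := abs_le.1 (h1.trans (Int.le_ceil _))
  exact ⟨by exact_mod_cast h2.1, by exact_mod_cast h2.2⟩

namespace IsDensityFn

variable {T : Set (EuclideanSpace ℝ (Fin 2))} {χ : EuclideanSpace ℝ (Fin 2) → ℝ}

lemma norm_le (h : IsDensityFn T χ) {R : ℝ} (hT : ∀ y ∈ T, ‖y‖ ≤ R)
    {x : EuclideanSpace ℝ (Fin 2)} (hx : χ x ≠ 0) : ‖x‖ ≤ R + 1 := by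
  by_contra! hlt
  refine hx (tendsto_nhds_unique (h x) (tendsto_const_nhds.congr' ?_))
  filter_upwards [mem_nhdsWithin_of_mem_nhds (Iio_mem_nhds one_pos)] with t ht
  have : T ∩ Metric.closedBall x t = ∅ := by
    refine Set.eq_empty_of_forall_notMem fun y hy => ?_
    have h1 := hT y hy.1
    have h2 : ‖x - y‖ ≤ t := by rw [← dist_eq_norm, dist_comm]; exact hy.2
    have h3 := norm_sub_norm_le x y
    have h4 : t < 1 := ht
    linarith
  simp [this]

lemma neg (h : IsDensityFn T χ) : IsDensityFn (-T) fun x => χ (-x) := by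
  intro x
  refine (h (-x)).congr fun t => ?_
  have h1 : T ∩ Metric.closedBall (-x) t = -(-T ∩ Metric.closedBall x t) := by
    simp [Set.inter_neg, neg_closedBall]
  rw [h1, ← neg_closedBall, Measure.measure_neg, Measure.measure_neg]

lemma measurable_s9 (h : IsDensityFn T χ) (hT : MeasurableSet T) : Measurable χ := by
  obtain ⟨u, -, hu, hu0⟩ := exists_seq_strictAnti_tendsto (0 : ℝ)
  have hu' : Tendsto u atTop (nhdsWithin 0 (Set.Ioi 0)) :=
    tendsto_nhdsWithin_iff.2 ⟨hu0, Eventually.of_forall hu⟩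
  refine measurable_of_tendsto_metrizable (fun n => ?_)
    (tendsto_pi_nhds.2 fun x => (h x).comp hu')
  have hm : ∀ S : Set (EuclideanSpace ℝ (Fin 2)), MeasurableSet S →
      Measurable fun x => (volume (S ∩ Metric.closedBall x (u n))).toReal := by
    intro S hS
    have hset : MeasurableSet {p : EuclideanSpace ℝ (Fin 2) × EuclideanSpace ℝ (Fin 2) |
        p.2 ∈ S ∧ dist p.2 p.1 ≤ u n} :=
      (measurable_snd hS).inter
        (measurableSet_le (measurable_snd.dist measurable_fst) measurable_const)
    exact (measurable_measure_prodMk_left hset).ennreal_toReal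
  have h2 := hm Set.univ MeasurableSet.univ
  simp only [Set.univ_inter] at h2
  exact (hm T hT).div h2

lemma norm_le_one (h : IsDensityFn T χ) (x : EuclideanSpace ℝ (Fin 2)) : ‖χ x‖ ≤ 1 := by
  refine le_of_tendsto (h x).norm (Eventually.of_forall fun t => ?_)
  rw [Real.norm_of_nonneg (by positivity)]
  exact div_le_one_of_le₀ (ENNReal.toReal_mono measure_closedBall_lt_top.ne
    (measure_mono Set.inter_subset_right)) ENNReal.toReal_nonneg

/-- Only finitely many lattice translates of a bounded set meet the support of `χ`. -/
lemma exists_finset (h : IsDensityFn T χ) {R : ℝ} (hT : ∀ y ∈ T, ‖y‖ ≤ R) {ε : ℝ} (hε : 0 < ε)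
    (M : ℝ) : ∃ Z : Finset (Fin 2 → ℤ), ∀ x : EuclideanSpace ℝ (Fin 2), ‖x‖ ≤ M →
      ∀ z ∉ Z, χ (x + latHom ε z) = 0 := by
  refine ⟨(finite_norm_latHom_le hε (R + 1 + M)).toFinset, fun x hx z hz => ?_⟩
  by_contra hne
  apply hz
  rw [Set.Finite.mem_toFinset, Set.mem_ofPred_eq]
  have h1 := h.norm_le hT hne
  have h2 : ‖latHom ε z‖ ≤ ‖x + latHom ε z‖ + ‖x‖ := by
    simpa using norm_sub_le (x + latHom ε z) x
  linarith

/-- Near `x`, the averages of the lattice point count of `T` are finite and converge to the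
lattice sum of `χ`. -/
lemma tendsto_latCount (h : IsDensityFn T χ) (hTm : MeasurableSet T) {R : ℝ}
    (hT : ∀ y ∈ T, ‖y‖ ≤ R) {ε : ℝ} (hε : 0 < ε) (x : EuclideanSpace ℝ (Fin 2)) :
    (∀ᶠ t in nhdsWithin (0 : ℝ) (Set.Ioi 0),
        ∫⁻ y in Metric.closedBall x t, latCount ε T y ≠ ⊤) ∧
      Tendsto (fun t : ℝ => (∫⁻ y in Metric.closedBall x t, latCount ε T y).toReal /
        (volume (Metric.closedBall x t)).toReal) (nhdsWithin 0 (Set.Ioi 0))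
        (nhds (∑' z, χ (x + latHom ε z))) := by
  set Z := (finite_norm_latHom_le hε (R + 1 + ‖x‖)).toFinset with hZ
  have hout : ∀ z ∉ Z, R + 1 < ‖x + latHom ε z‖ := by
    intro z hz
    rw [hZ, Set.Finite.mem_toFinset, Set.mem_ofPred_eq, not_le] at hz
    have h2 : ‖latHom ε z‖ ≤ ‖x + latHom ε z‖ + ‖x‖ := by
      simpa using norm_sub_le (x + latHom ε z) x
    linarith
  have hχ : ∑' z, χ (x + latHom ε z) = ∑ z ∈ Z, χ (x + latHom ε z) := by
    refine tsum_eq_sum fun z hz => ?_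
    by_contra hne
    exact (hout z hz).not_ge (h.norm_le hT hne)
  have hsum : ∀ᶠ t in nhdsWithin (0 : ℝ) (Set.Ioi 0),
      ∫⁻ y in Metric.closedBall x t, latCount ε T y =
        ∑ z ∈ Z, volume (T ∩ Metric.closedBall (x + latHom ε z) t) := by
    filter_upwards [mem_nhdsWithin_of_mem_nhds (Iio_mem_nhds one_pos)] with t ht
    rw [setLIntegral_latCount_closedBall ε hTm]
    refine tsum_eq_sum fun z hz => ?_
    have : T ∩ Metric.closedBall (x + latHom ε z) t = ∅ := by
      refine Set.eq_empty_of_forall_notMem fun y hy => ?_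
      have h1 := hT y hy.1
      have h2 : ‖x + latHom ε z - y‖ ≤ t := by rw [← dist_eq_norm, dist_comm]; exact hy.2
      have h3 := norm_sub_norm_le (x + latHom ε z) y
      have h4 : t < 1 := ht
      linarith [hout z hz]
    rw [this, measure_empty]
  have hfin : ∀ z t, volume (T ∩ Metric.closedBall (x + latHom ε z) t) ≠ ⊤ := fun z t =>
    ((measure_mono Set.inter_subset_right).trans_lt measure_closedBall_lt_top).ne
  refine ⟨hsum.mono fun t ht => ?_, ?_⟩
  · rw [ht]
    exact ENNReal.sum_ne_top.2 fun z _ => hfin z t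
  · rw [hχ]
    refine (tendsto_finsetSum Z fun z _ => h (x + latHom ε z)).congr' ?_
    filter_upwards [hsum] with t ht
    rw [ht, ENNReal.toReal_sum fun z _ => hfin z t, Finset.sum_div]
    refine Finset.sum_congr rfl fun z _ => ?_
    rw [Measure.addHaar_closedBall_center, Measure.addHaar_closedBall_center volume x]

lemma tsum_add_tsum_neg (h : IsDensityFn T χ) (hTm : MeasurableSet T) {R : ℝ}
    (hT : ∀ y ∈ T, ‖y‖ ≤ R) {ε : ℝ} (hε : 0 < ε) {D : ENNReal}
    (hD : ∀ᵐ y : EuclideanSpace ℝ (Fin 2), latCount ε T y + latCount ε (-T) y = D)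
    (x : EuclideanSpace ℝ (Fin 2)) :
    ∑' z, χ (x + latHom ε z) + ∑' z, χ (-x + latHom ε z) = D.toReal := by
  obtain ⟨h1, h2⟩ := h.tendsto_latCount hTm hT hε x
  obtain ⟨h3, h4⟩ := h.neg.tendsto_latCount hTm.neg
    (fun y hy => norm_neg y ▸ hT (-y) hy) hε x
  have hre : ∑' z, χ (-(x + latHom ε z)) = ∑' z, χ (-x + latHom ε z) := by
    rw [← (Equiv.neg (Fin 2 → ℤ)).tsum_eq]
    refine tsum_congr fun z => ?_
    simp [add_comm]
  rw [hre] at h4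
  refine tendsto_nhds_unique (h2.add h4) (tendsto_const_nhds.congr' ?_)
  filter_upwards [h1, h3, self_mem_nhdsWithin] with t ht1 ht3 ht
  have hpos : 0 < (volume (Metric.closedBall x t)).toReal :=
    ENNReal.toReal_pos (Metric.measure_closedBall_pos volume x ht).ne'
      measure_closedBall_lt_top.ne
  rw [← add_div, ← ENNReal.toReal_add ht1 ht3, ← lintegral_add_left (measurable_latCount ε hTm),
    lintegral_congr_ae (ae_restrict_of_ae hD), setLIntegral_const, ENNReal.toReal_mul,
    mul_div_cancel_right₀ _ hpos.ne']

/-- Lattice sums of `χ` are integrable along bonds. -/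
lemma intervalIntegrable_tsum (h : IsDensityFn T χ) (hTm : MeasurableSet T) {R : ℝ}
    (hT : ∀ y ∈ T, ‖y‖ ≤ R) {ε : ℝ} (hε : 0 < ε) (p q : EuclideanSpace ℝ (Fin 2)) :
    IntervalIntegrable (fun t : ℝ => ∑' z, χ (p + t • q + latHom ε z)) volume 0 1 := by
  obtain ⟨Z, hZ⟩ := h.exists_finset hT hε (‖p‖ + ‖q‖)
  rw [intervalIntegrable_iff_integrableOn_Ioc_of_le zero_le_one]
  have hint : IntegrableOn (fun t : ℝ => ∑ z ∈ Z, χ (p + t • q + latHom ε z))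
      (Set.Ioc 0 1) volume := by
    refine integrable_finsetSum Z fun z _ => ?_
    refine Integrable.of_bound ?_ 1 (Eventually.of_forall fun t => h.norm_le_one _)
    exact ((h.measurable_s9 hTm).comp (by fun_prop)).aestronglyMeasurable
  refine hint.congr_fun (fun t ht => ?_) measurableSet_Ioc
  refine (tsum_eq_sum fun z hz => hZ _ ?_ z hz).symm
  refine (norm_add_le _ _).trans ?_
  rw [norm_smul, Real.norm_of_nonneg ht.1.le]
  gcongr
  exact mul_le_of_le_one_left (norm_nonneg q) ht.2

end IsDensityFn

/-- The cell `{−N+1,…,N}²` is a set of representatives of `ℤ²` modulo `2Nℤ²`. -/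
lemma bijective_cell2 {N : ℕ} (hN : 1 ≤ N) :
    Function.Bijective fun p : cell2 N × (Fin 2 → ℤ) => p.1.1 + (2 * N : ℤ) • p.2 := by
  have hmem : ∀ x, x ∈ cell2 N ↔ ∀ i, -(N : ℤ) + 1 ≤ x i ∧ x i ≤ N := by
    intro x; simp [cell2, Fintype.mem_piFinset]
  have hN' : (0 : ℤ) < 2 * N := by omega
  constructor
  · rintro ⟨⟨x, hx⟩, ξ⟩ ⟨⟨y, hy⟩, η⟩ hxy
    have hi : ∀ i, x i = y i ∧ ξ i = η i := by
      intro i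
      have e : x i + 2 * N * ξ i = y i + 2 * N * η i := by simpa using congrFun hxy i
      have h1 := (hmem x).1 hx i
      have h2 := (hmem y).1 hy i
      have h3 : ξ i = η i := by
        rcases lt_trichotomy (ξ i) (η i) with hlt | heq | hlt
        · nlinarith
        · exact heq
        · nlinarith
      rw [h3] at e
      exact ⟨by linarith, h3⟩
    ext i
    · exact (hi i).1
    · exact (hi i).2
  · intro z
    refine ⟨⟨⟨fun i => (z i + N - 1) % (2 * N) - N + 1, (hmem _).2 fun i => ?_⟩,
      fun i => (z i + N - 1) / (2 * N)⟩, ?_⟩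
    · have h1 := Int.emod_nonneg (z i + N - 1) hN'.ne'
      have h2 := Int.emod_lt_of_pos (z i + N - 1) hN'
      constructor <;> linarith
    · ext i
      have := Int.emod_add_mul_ediv (z i + N - 1) (2 * N)
      simp only [Pi.add_apply, Pi.smul_apply, smul_eq_mul]
      linarith

lemma sum_cell2_tsum {N : ℕ} (hN : 1 ≤ N) {h : EuclideanSpace ℝ (Fin 2) → ℝ}
    (hfin : Summable fun z => h (latHom (1 / (N : ℝ)) z)) :
    ∑ x ∈ cell2 N, ∑' ξ, h (latHom (1 / (N : ℝ)) x + latHom 2 ξ) =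
      ∑' z, h (latHom (1 / (N : ℝ)) z) := by
  have hN' : (N : ℝ) ≠ 0 := by positivity
  let e := Equiv.ofBijective _ (bijective_cell2 hN)
  have he : ∀ p, h (latHom (1 / (N : ℝ)) (e p)) =
      h (latHom (1 / (N : ℝ)) p.1.1 + latHom 2 p.2) := by
    intro p
    congr 1
    ext i
    simp [e, Equiv.ofBijective]
    field_simp
  have hfin' := e.summable_iff.2 hfin
  simp only [Function.comp_def, he] at hfin'
  rw [← e.tsum_eq (fun z => h (latHom (1 / (N : ℝ)) z)), ← Finset.sum_coe_sort (cell2 N)]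
  simp_rw [he]
  rw [hfin'.tsum_prod, tsum_fintype]

/-- Periodic bond density lemma: with `ε = 1/N`,
`ε² ∑_{x∈𝓛} ⨍_x^{x+εr} χ_{T^#} db = |T|`, where `χ_{T^#}(x) = ∑_{ξ∈2ℤ²} χ_T(x − ξ)`. -/
theorem stmt_9 (N : ℕ) (hN : 1 ≤ N) (a b c : Fin 2 → ℤ)
    (hnd : AffineIndependent ℝ
      ![latpt (1 / (N : ℝ)) a, latpt (1 / (N : ℝ)) b, latpt (1 / (N : ℝ)) c])
    (r : Fin 2 → ℤ)
    (χ : EuclideanSpace ℝ (Fin 2) → ℝ)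
    (hχ : IsDensityFn
      (convexHull ℝ {latpt (1 / (N : ℝ)) a, latpt (1 / (N : ℝ)) b, latpt (1 / (N : ℝ)) c}
        : Set (EuclideanSpace ℝ (Fin 2))) χ) :
    (1 / (N : ℝ)) ^ 2 * ∑ x ∈ cell2 N,
        (∫ t in (0:ℝ)..1, ∑' ξ : Fin 2 → ℤ,
          χ (latpt (1 / (N : ℝ)) x + t • ((1 / (N : ℝ)) • zvec r) - latpt 2 ξ))
      = (volume (convexHull ℝ
          {latpt (1 / (N : ℝ)) a, latpt (1 / (N : ℝ)) b, latpt (1 / (N : ℝ)) c}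
          : Set (EuclideanSpace ℝ (Fin 2)))).toReal := by
  have hN' : (0 : ℝ) < N := by positivity
  set ε : ℝ := 1 / (N : ℝ)
  have hε : 0 < ε := by positivity
  set T : Set (EuclideanSpace ℝ (Fin 2)) :=
    convexHull ℝ {latpt ε a, latpt ε b, latpt ε c}
  have hTc : IsCompact T := (Set.toFinite _).isCompact_convexHull ℝ
  have hTm : MeasurableSet T := hTc.isClosed.measurableSet
  obtain ⟨R, hR⟩ := hTc.isBounded.exists_norm_le
  obtain ⟨D, hD⟩ := exists_latCount_add_latCount_neg_eq ε a b c hnd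
  have hDval := mul_eq_two_mul_volume hε hTm hD
  have hrefl := hχ.tsum_add_tsum_neg hTm hR hε hD
  have hq : ε • zvec r = latHom ε r := by
    ext i; simp [zvec, toV2]
  have hbond : ∀ x (t : ℝ), ∑' ξ, χ (latpt ε x + t • (ε • zvec r) - latpt 2 ξ) =
      ∑' ξ, χ (latHom ε x + t • latHom ε r + latHom 2 ξ) := by
    intro x t
    rw [hq, ← (Equiv.neg (Fin 2 → ℤ)).tsum_eq]
    refine tsum_congr fun ξ => ?_
    rw [sub_eq_add_neg]
    change χ (_ + -(latHom 2 (-ξ))) = _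
    rw [map_neg, neg_neg]
    rfl
  have hcell : ∀ t : ℝ, ∑ x ∈ cell2 N, ∑' ξ, χ (latHom ε x + t • latHom ε r + latHom 2 ξ) =
      ∑' z, χ (t • latHom ε r + latHom ε z) := by
    intro t
    obtain ⟨Z, hZ⟩ := hχ.exists_finset hR hε ‖t • latHom ε r‖
    rw [← sum_cell2_tsum hN (h := fun y => χ (t • latHom ε r + y))
      (summable_of_ne_finset_zero fun z hz => hZ _ le_rfl z hz)]
    refine Finset.sum_congr rfl fun x _ => tsum_congr fun ξ => ?_
    congr 1
    abel
  simp_rw [hbond]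
  rw [← intervalIntegral.integral_finsetSum fun x _ =>
    hχ.intervalIntegrable_tsum hTm hR two_pos (latHom ε x) (latHom ε r)]
  simp_rw [hcell]
  have hint : IntervalIntegrable (fun t : ℝ => ∑' z, χ (t • latHom ε r + latHom ε z))
      volume 0 1 := by
    simpa using hχ.intervalIntegrable_tsum hTm hR hε 0 (latHom ε r)
  have hsymm : ∀ t : ℝ, ∑' z, χ ((1 - t) • latHom ε r + latHom ε z) =
      D.toReal - ∑' z, χ (t • latHom ε r + latHom ε z) := by
    intro t
    rw [← hrefl (t • latHom ε r), add_sub_cancel_left,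
      ← (Equiv.addLeft r).tsum_eq (fun z => χ (-(t • latHom ε r) + latHom ε z))]
    refine tsum_congr fun z => ?_
    rw [Equiv.coe_addLeft, map_add, sub_smul, one_smul]
    congr 1
    abel
  have hI := intervalIntegral.integral_comp_sub_left
    (fun t : ℝ => ∑' z, χ (t • latHom ε r + latHom ε z)) (1 : ℝ) (a := 0) (b := 1)
  simp_rw [hsymm] at hI
  rw [intervalIntegral.integral_sub intervalIntegrable_const hint] at hI
  simp only [intervalIntegral.integral_const, sub_zero, sub_self, one_smul] at hI
  linear_combination (1 / 2) * hDval - (ε ^ 2 / 2) * hI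
end
end
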